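/- arXiv:2410.18343 — 2 statements merged into one kernel-verified Lean document; each statement's English description precedes it below -/
import Mathlib

section
/- For any skew shape μ/λ, the GG-jdt map jdt_GG is a bijection from the set of α-column-strict, β-row-strict, (α,β)-sorted mixed tableaux of shape μ/λ onto the set of mixed tableaux E of shape μ/λ such that c_β^+(E) is totally column-strict. -/
/-!
Common definitions: mixed tableaux, tableau switching, shuffling, GG-jdt,
hook-valued tableaux and the uncrowding algorithms.
Conventions: French notation, cells `(i, j)` with `i` the row index (counted
from the bottom) and `j` the column index, both `≥ 1`.
-/

open scoped Classical

abbrev Cell : Type := ℕ × ℕ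

/-- The cell directly above `c`. -/
def upCell (c : Cell) : Cell := (c.1 + 1, c.2)

/-- The cell directly to the right of `c`. -/
def rtCell (c : Cell) : Cell := (c.1, c.2 + 1)

/-- A (finite) partition shape: a finite lower-order ideal of cells in the
positive quadrant (1-indexed, French notation). -/
def IsPartitionShape (s : Set Cell) : Prop :=
  s.Finite ∧ (∀ c ∈ s, 1 ≤ c.1 ∧ 1 ≤ c.2) ∧
    ∀ i j i' j' : ℕ, (i, j) ∈ s → 1 ≤ i' → i' ≤ i → 1 ≤ j' → j' ≤ j → (i', j') ∈ s

/-- Entries of mixed tableaux: `al k` represents `α_k`, `be k` represents `β_k`. -/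
inductive MEntry : Type
  | al (k : ℤ)
  | be (k : ℤ)
  deriving DecidableEq

/-- The index of a mixed entry. -/
def MEntry.idx : MEntry → ℤ
  | .al k => k
  | .be k => k

def MEntry.isAlpha : MEntry → Prop
  | .al _ => True
  | .be _ => False

def MEntry.isBeta : MEntry → Prop
  | .al _ => False
  | .be _ => True

/-- A mixed tableau: a partial filling of cells with mixed entries. -/
abbrev MixedTableau : Type := Cell → Option MEntry

/-- The set of cells filled in a mixed tableau. -/
def mshape (T : MixedTableau) : Set Cell := {c | T c ≠ none}

/-- A legal mixed tableau: finitely many cells, all in the positive quadrant,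
and indices of `α` entries are positive. -/
def IsMixedTableau (T : MixedTableau) : Prop :=
  (mshape T).Finite ∧ (∀ c ∈ mshape T, 1 ≤ c.1 ∧ 1 ≤ c.2) ∧
    ∀ c k, T c = some (MEntry.al k) → 0 < k

/-- `T` is a filling of the skew shape `mu / lam`. -/
def HasSkewShape (T : MixedTableau) (lam mu : Set Cell) : Prop :=
  IsPartitionShape lam ∧ IsPartitionShape mu ∧ lam ⊆ mu ∧ mshape T = mu \ lam

/-- `γ`-column-strictness for the entries selected by `p`:
indices weakly decrease to the northeast, and no two selected entries in the
same column have equal indices. -/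
def ColumnStrictFor (p : MEntry → Prop) (T : MixedTableau) : Prop :=
  (∀ c c' e e', T c = some e → T c' = some e' → p e → p e' →
      c.1 ≤ c'.1 → c.2 ≤ c'.2 → MEntry.idx e' ≤ MEntry.idx e) ∧
  (∀ c c' e e', T c = some e → T c' = some e' → p e → p e' →
      c.2 = c'.2 → c ≠ c' → MEntry.idx e ≠ MEntry.idx e')

/-- `γ`-row-strictness for the entries selected by `p`. -/
def RowStrictFor (p : MEntry → Prop) (T : MixedTableau) : Prop :=
  (∀ c c' e e', T c = some e → T c' = some e' → p e → p e' →
      c.1 ≤ c'.1 → c.2 ≤ c'.2 → MEntry.idx e' ≤ MEntry.idx e) ∧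
  (∀ c c' e e', T c = some e → T c' = some e' → p e → p e' →
      c.1 = c'.1 → c ≠ c' → MEntry.idx e ≠ MEntry.idx e')

def AlphaColumnStrict (T : MixedTableau) : Prop := ColumnStrictFor MEntry.isAlpha T
def AlphaRowStrict (T : MixedTableau) : Prop := RowStrictFor MEntry.isAlpha T
def BetaColumnStrict (T : MixedTableau) : Prop := ColumnStrictFor MEntry.isBeta T
def BetaRowStrict (T : MixedTableau) : Prop := RowStrictFor MEntry.isBeta T

def alphaCells (T : MixedTableau) : Set Cell := {c | ∃ k, T c = some (MEntry.al k)}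
def betaCells (T : MixedTableau) : Set Cell := {c | ∃ k, T c = some (MEntry.be k)}

/-- `(α,β)`-sortedness relative to the skew shape `mu / lam`: the `α`-cells form
`nu / lam` and the `β`-cells form `mu / nu` for some partition `nu`. -/
def ABSortedShape (T : MixedTableau) (lam mu : Set Cell) : Prop :=
  ∃ nu : Set Cell, IsPartitionShape nu ∧ lam ⊆ nu ∧ nu ⊆ mu ∧
    alphaCells T = nu \ lam ∧ betaCells T = mu \ nu

/-- `(α,β)`-sorted. -/
def ABSorted (T : MixedTableau) : Prop :=
  ∃ lam mu : Set Cell, HasSkewShape T lam mu ∧ ABSortedShape T lam mu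

/-- `(β,α)`-sortedness relative to the skew shape `mu / lam`. -/
def BASortedShape (T : MixedTableau) (lam mu : Set Cell) : Prop :=
  ∃ nu : Set Cell, IsPartitionShape nu ∧ lam ⊆ nu ∧ nu ⊆ mu ∧
    betaCells T = nu \ lam ∧ alphaCells T = mu \ nu

/-- `(β,α)`-sorted. -/
def BASorted (T : MixedTableau) : Prop :=
  ∃ lam mu : Set Cell, HasSkewShape T lam mu ∧ BASortedShape T lam mu

/-- Interchange the contents of two cells. -/
def swapCells (T : MixedTableau) (c c' : Cell) : MixedTableau :=
  Function.update (Function.update T c (T c')) c' (T c)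

/-- A switch: interchange an `α_r` with a `β_s` directly to its right or
directly above it, provided both the source and the result are
`α`-column-strict and `β`-row-strict. -/
def Switch (T T' : MixedTableau) : Prop :=
  AlphaColumnStrict T ∧ BetaRowStrict T ∧
  ∃ c c' : Cell, (c' = rtCell c ∨ c' = upCell c) ∧
    (∃ r, T c = some (MEntry.al r)) ∧ (∃ s, T c' = some (MEntry.be s)) ∧
    T' = swapCells T c c' ∧ AlphaColumnStrict T' ∧ BetaRowStrict T'

/-- Fully switched: no switch is possible. -/
def FullySwitched (T : MixedTableau) : Prop := ¬ ∃ T', Switch T T'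

/-- The cell `c` contains a `β` entry. -/
def isBetaCell (T : MixedTableau) (c : Cell) : Prop := ∃ k, T c = some (MEntry.be k)

/-- One step of the switching process of the shuffle: the `α` entry at `c`
moves to the cell `c'` (above or to the right), following the tie-breaking
rule of the jeu de taquin shuffle. -/
def ShuffMoveTo (Q : MixedTableau) (c c' : Cell) (Q' : MixedTableau) : Prop :=
  (∃ i, Q c = some (MEntry.al i)) ∧ Q' = swapCells Q c c' ∧
  ((isBetaCell Q (rtCell c) ∧ ¬ isBetaCell Q (upCell c) ∧ c' = rtCell c) ∨
   (isBetaCell Q (upCell c) ∧ ¬ isBetaCell Q (rtCell c) ∧ c' = upCell c) ∨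
   (∃ k j, Q (upCell c) = some (MEntry.be k) ∧ Q (rtCell c) = some (MEntry.be j) ∧
      ((j < k ∧ c' = upCell c) ∨ (k ≤ j ∧ c' = rtCell c))))

/-- The `α` entry at `c` is settled: the cells above and to the right of it
contain `α` entries or are empty. -/
def ShuffSettled (Q : MixedTableau) (c : Cell) : Prop :=
  ¬ isBetaCell Q (upCell c) ∧ ¬ isBetaCell Q (rtCell c)

/-- The full switching process of a single chosen `α` entry, starting at cell `c`,
until it is settled. -/
inductive ShuffTrack : MixedTableau → Cell → MixedTableau → Prop
  | done : ∀ Q c, ShuffSettled Q c → ShuffTrack Q c Q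
  | step : ∀ Q c c' Q' R, ShuffMoveTo Q c c' Q' → ShuffTrack Q' c' R → ShuffTrack Q c R

/-- The cell `c` holds an `α` entry having a `β` entry directly above or
directly to its right. -/
def ShuffPending (Q : MixedTableau) (c : Cell) : Prop :=
  (∃ i, Q c = some (MEntry.al i)) ∧ (isBetaCell Q (upCell c) ∨ isBetaCell Q (rtCell c))

/-- Among the pending `α` entries, the rightmost one with the smallest index. -/
def ShuffChosen (Q : MixedTableau) (c : Cell) : Prop :=
  ShuffPending Q c ∧ ∃ i, Q c = some (MEntry.al i) ∧
    (∀ c' i', ShuffPending Q c' → Q c' = some (MEntry.al i') → i ≤ i') ∧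
    (∀ c', ShuffPending Q c' → Q c' = some (MEntry.al i) → c'.2 ≤ c.2)

/-- `ShuffRel Q R` means `R = shuff(Q)`, the jeu de taquin shuffle of `Q`. -/
inductive ShuffRel : MixedTableau → MixedTableau → Prop
  | done : ∀ Q, (∀ c, ¬ ShuffPending Q c) → ShuffRel Q Q
  | step : ∀ Q c Q' R, ShuffChosen Q c → ShuffTrack Q c Q' → ShuffRel Q' R → ShuffRel Q R

/-- The entry `α_r` at `c` is out of order via its right neighbour. -/
def OutOfOrderH (T : MixedTableau) (c : Cell) : Prop :=
  ∃ r s : ℤ, T c = some (MEntry.al r) ∧ T (rtCell c) = some (MEntry.be s) ∧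
    r < s + ((c.2 : ℤ) + 1) - (c.1 : ℤ)

/-- The entry `α_r` at `c` is out of order via its upper neighbour. -/
def OutOfOrderV (T : MixedTableau) (c : Cell) : Prop :=
  ∃ r t : ℤ, T c = some (MEntry.al r) ∧ T (upCell c) = some (MEntry.be t) ∧
    r ≤ t + (c.2 : ℤ) - ((c.1 : ℤ) + 1)

def OutOfOrder (T : MixedTableau) (c : Cell) : Prop := OutOfOrderH T c ∨ OutOfOrderV T c

/-- The GG-jdt slide at the cell `c`. -/
def GGSlide (T : MixedTableau) (c : Cell) (T' : MixedTableau) : Prop :=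
  (OutOfOrderH T c ∧ ¬ OutOfOrderV T c ∧ T' = swapCells T c (rtCell c)) ∨
  (OutOfOrderV T c ∧ ¬ OutOfOrderH T c ∧ T' = swapCells T c (upCell c)) ∨
  (OutOfOrderH T c ∧ OutOfOrderV T c ∧
    ∃ s t : ℤ, T (rtCell c) = some (MEntry.be s) ∧ T (upCell c) = some (MEntry.be t) ∧
      ((t ≤ s ∧ T' = swapCells T c (rtCell c)) ∨ (s < t ∧ T' = swapCells T c (upCell c))))

/-- The cell chosen by the GG-jdt map: the rightmost cell containing an
out-of-order `α_r` with `r` smallest. -/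
def GGChosen (T : MixedTableau) (c : Cell) : Prop :=
  ∃ r : ℤ, T c = some (MEntry.al r) ∧ OutOfOrder T c ∧
    (∀ c' r', T c' = some (MEntry.al r') → OutOfOrder T c' → r ≤ r') ∧
    (∀ c', T c' = some (MEntry.al r) → OutOfOrder T c' → c'.2 ≤ c.2)

/-- One iteration of the GG-jdt map. -/
def GGStep (T T' : MixedTableau) : Prop := ∃ c, GGChosen T c ∧ GGSlide T c T'

/-- `GGRel T R` means `R = jdt_GG(T)`. -/
def GGRel (T R : MixedTableau) : Prop :=
  Relation.ReflTransGen GGStep T R ∧ ∀ c, ¬ OutOfOrder R c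

/-- `c_β^+`: replace each `β_r` in a cell of content `c = j - i` by `β_{r+c}`. -/
def cBetaPlus (T : MixedTableau) : MixedTableau := fun c =>
  match T c with
  | some (MEntry.be r) => some (MEntry.be (r + ((c.2 : ℤ) - (c.1 : ℤ))))
  | o => o

/-- Totally column-strict: indices strictly decrease up columns and weakly
decrease along rows. -/
def TotallyColumnStrict (T : MixedTableau) : Prop :=
  (∀ c e e', T c = some e → T (upCell c) = some e' → MEntry.idx e' < MEntry.idx e) ∧
  (∀ c e e', T c = some e → T (rtCell c) = some e' → MEntry.idx e' ≤ MEntry.idx e)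

/-- Flagged-mixed tableau: `α_k` in column `j` forces `0 < k < j`, and
`β_k` in row `i` forces `0 < k < i`. -/
def IsFMT (T : MixedTableau) : Prop :=
  (∀ c k, T c = some (MEntry.al k) → 0 < k ∧ k < (c.2 : ℤ)) ∧
  (∀ c k, T c = some (MEntry.be k) → 0 < k ∧ k < (c.1 : ℤ))

/-- Exquisite tableau of shape `mu / lam`. -/
def IsEXQ (lam mu : Set Cell) (E : MixedTableau) : Prop :=
  IsMixedTableau E ∧ HasSkewShape E lam mu ∧ IsFMT E ∧
    TotallyColumnStrict (cBetaPlus E)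

/-- Biflagged tableau of shape `mu / lam`. -/
def IsBFT (lam mu : Set Cell) (Q : MixedTableau) : Prop :=
  IsMixedTableau Q ∧ HasSkewShape Q lam mu ∧
  AlphaColumnStrict Q ∧ BetaRowStrict Q ∧ ABSortedShape Q lam mu ∧
  IsFMT Q ∧ (∃ R, ShuffRel Q R) ∧ (∀ R, ShuffRel Q R → IsFMT R)

/-- Number of occurrences of the entry `e` in the mixed tableau `Q`:
the exponent of the corresponding variable in `wt(Q)`. -/
noncomputable def mcount (Q : MixedTableau) (e : MEntry) : ℕ :=
  Set.ncard {c | Q c = some e}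

/-! ### Hook-valued tableaux -/

/-- A hook: a hook entry, a list of leg entries and a list of arm entries. -/
structure Hook : Type where
  hk : ℕ
  legs : List ℕ
  arms : List ℕ
  deriving DecidableEq

/-- Valid hook: positive entries, `hk < L₁ < ⋯ < L_ℓ` and `hk ≤ A₁ ≤ ⋯ ≤ A_k`. -/
def Hook.Valid (H : Hook) : Prop :=
  1 ≤ H.hk ∧ H.legs.Chain' (· < ·) ∧ (∀ x ∈ H.legs, H.hk < x) ∧
  H.arms.Chain' (· ≤ ·) ∧ ∀ x ∈ H.arms, H.hk ≤ x

/-- The multiset of all entries of a hook. -/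
def Hook.entries (H : Hook) : Multiset ℕ :=
  H.hk ::ₘ ((H.legs : Multiset ℕ) + (H.arms : Multiset ℕ))

/-- A hook-valued filling. -/
abbrev HVTab : Type := Cell → Option Hook

def hshape (T : HVTab) : Set Cell := {c | T c ≠ none}

noncomputable def hsize (T : HVTab) : ℕ := (hshape T).ncard

def hentriesAt (T : HVTab) (c : Cell) : Multiset ℕ :=
  match T c with
  | some H => H.entries
  | none => 0

def armsAt (T : HVTab) (c : Cell) : List ℕ :=
  match T c with
  | some H => H.arms
  | none => []

def legsAt (T : HVTab) (c : Cell) : List ℕ :=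
  match T c with
  | some H => H.legs
  | none => []

/-- Hook-valued tableau: partition shape, valid hooks, rows weakly increasing
(entrywise) and columns strictly increasing (entrywise). -/
def IsHVT (T : HVTab) : Prop :=
  IsPartitionShape (hshape T) ∧
  (∀ c H, T c = some H → H.Valid) ∧
  (∀ c, ∀ x ∈ hentriesAt T c, ∀ y ∈ hentriesAt T (rtCell c), x ≤ y) ∧
  (∀ c, ∀ x ∈ hentriesAt T c, ∀ y ∈ hentriesAt T (upCell c), x < y)

def NoArms (T : HVTab) : Prop := ∀ c, armsAt T c = []
def NoLegs (T : HVTab) : Prop := ∀ c, legsAt T c = []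

/-- Insert into a sorted list. -/
def insSorted (x : ℕ) : List ℕ → List ℕ
  | [] => [x]
  | y :: ys => if x ≤ y then x :: y :: ys else y :: insSorted x ys

def insSortedAll (xs : List ℕ) (l : List ℕ) : List ℕ :=
  xs.foldl (fun acc x => insSorted x acc) l

/-- In arm-uncrowding, the receiving cell's hook: replace its entry `k`
(the smallest entry `≥ a`) by `a` and insert `k` as an arm entry. -/
def Hook.receiveArm (H : Hook) (a k : ℕ) : Hook :=
  if H.hk = k then ⟨a, H.legs, insSorted k H.arms⟩
  else if k ∈ H.legs then ⟨H.hk, insSorted a (H.legs.erase k), insSorted k H.arms⟩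
  else ⟨H.hk, H.legs, insSorted a H.arms⟩

/-- In leg-uncrowding, the receiving cell's hook: replace its entry `k`
(the smallest entry `> l`) by `l` and insert `k` as a leg entry. -/
def Hook.receiveLeg (H : Hook) (l k : ℕ) : Hook :=
  if H.hk = k then ⟨l, insSorted k H.legs, H.arms⟩
  else if k ∈ H.legs then ⟨H.hk, insSorted l H.legs, H.arms⟩
  else ⟨H.hk, insSorted k H.legs, insSorted l (H.arms.erase k)⟩

/-- Add the arm entries `xs` to the cell `c` of `T`. -/
def addArmsAt (T : HVTab) (c : Cell) (xs : List ℕ) : HVTab :=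
  if xs = [] then T
  else
    match T c with
    | some H => Function.update T c (some ⟨H.hk, H.legs, insSortedAll xs H.arms⟩)
    | none => Function.update T c (some ⟨xs.headI, [], xs.tail⟩)

/-- The arm entry selected by arm-uncrowding: `a` is the largest arm entry in
the rightmost column `c` containing an arm entry, located in cell `(r, c)`. -/
def SelectedArm (T : HVTab) (r c a : ℕ) : Prop :=
  a ∈ armsAt T (r, c) ∧
  (∀ r' x, x ∈ armsAt T (r', c) → x ≤ a) ∧
  (∀ r' c', c < c' → armsAt T (r', c') = [])

/-- The leg entry selected by leg-uncrowding: `l` is the largest leg entry in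
the topmost row `r` containing a leg entry, located in cell `(r, c)`. -/
def SelectedLeg (T : HVTab) (r c l : ℕ) : Prop :=
  l ∈ legsAt T (r, c) ∧
  (∀ c' x, x ∈ legsAt T (r, c') → x ≤ l) ∧
  (∀ r' c', r < r' → legsAt T (r', c') = [])

/-- `k` is the smallest entry `≥ a` in column `col`, located in row `rr`. -/
def SmallestGE (T : HVTab) (col a k rr : ℕ) : Prop :=
  k ∈ hentriesAt T (rr, col) ∧ a ≤ k ∧
  ∀ r' y, y ∈ hentriesAt T (r', col) → a ≤ y → k ≤ y

/-- `k` is the smallest entry `> l` in row `row`, located in column `cc`. -/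
def SmallestGT (T : HVTab) (row l k cc : ℕ) : Prop :=
  k ∈ hentriesAt T (row, cc) ∧ l < k ∧
  ∀ c' y, y ∈ hentriesAt T (row, c') → l < y → k ≤ y

/-- The arm-uncrowding bumping `A_b`. -/
def ArmBumpRel (T T' : HVTab) : Prop :=
  (NoArms T ∧ T' = T) ∨
  (∃ r c a H, T (r, c) = some H ∧ SelectedArm T r c a ∧
    ((∃ k rr HT, SmallestGE T (c + 1) a k rr ∧ T (rr, c + 1) = some HT ∧
        ((rr ≠ r ∧
            T' = Function.update (Function.update T (r, c)
                (some ⟨H.hk, H.legs, H.arms.erase a⟩)) (rr, c + 1)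
                (some (Hook.receiveArm HT a k))) ∨
         (rr = r ∧
            T' = Function.update (Function.update T (r, c)
                (some ⟨H.hk, H.legs.filter (fun x => decide (x ≤ a)), H.arms.erase a⟩))
                (r, c + 1)
                (some ⟨(Hook.receiveArm HT a k).hk,
                       insSortedAll (H.legs.filter (fun x => decide (a < x)))
                         (Hook.receiveArm HT a k).legs,
                       (Hook.receiveArm HT a k).arms⟩)))) ∨
     ((∀ r' y, y ∈ hentriesAt T (r', c + 1) → y < a) ∧
        ∃ t, 1 ≤ t ∧ (∀ r', (r', c + 1) ∈ hshape T ↔ 1 ≤ r' ∧ r' < t) ∧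
        ((t ≠ r ∧
            T' = Function.update (Function.update T (r, c)
                (some ⟨H.hk, H.legs, H.arms.erase a⟩)) (t, c + 1)
                (some ⟨a, [], []⟩)) ∨
         (t = r ∧
            T' = Function.update (Function.update T (r, c)
                (some ⟨H.hk, H.legs.filter (fun x => decide (x ≤ a)), H.arms.erase a⟩))
                (r, c + 1)
                (some ⟨a, H.legs.filter (fun x => decide (a < x)), []⟩))))))

/-- The leg-uncrowding bumping `L_b`. -/
def LegBumpRel (T T' : HVTab) : Prop :=
  (NoLegs T ∧ T' = T) ∨
  (∃ r c l H, T (r, c) = some H ∧ SelectedLeg T r c l ∧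
    ((∃ k cc HT, SmallestGT T (r + 1) l k cc ∧ T (r + 1, cc) = some HT ∧
        ((cc ≠ c ∧
            T' = Function.update (Function.update T (r, c)
                (some ⟨H.hk, H.legs.erase l, H.arms⟩)) (r + 1, cc)
                (some (Hook.receiveLeg HT l k))) ∨
         (cc = c ∧
            T' = addArmsAt
              (Function.update (Function.update T (r, c)
                  (some ⟨H.hk, H.legs.erase l, H.arms.filter (fun x => decide (l < x))⟩))
                  (r + 1, c) (some (Hook.receiveLeg HT l k)))
              (r, c + 1) (H.arms.filter (fun x => decide (x ≤ l)))))) ∨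
     ((∀ c' y, y ∈ hentriesAt T (r + 1, c') → y ≤ l) ∧
        ∃ t, 1 ≤ t ∧ (∀ c', (r + 1, c') ∈ hshape T ↔ 1 ≤ c' ∧ c' < t) ∧
        ((t ≠ c ∧
            T' = Function.update (Function.update T (r, c)
                (some ⟨H.hk, H.legs.erase l, H.arms⟩)) (r + 1, t)
                (some ⟨l, [], []⟩)) ∨
         (t = c ∧
            T' = Function.update (Function.update T (r, c)
                (some ⟨H.hk, H.legs.erase l, H.arms.filter (fun x => decide (l < x))⟩))
                (r + 1, c)
                (some ⟨l, [], H.arms.filter (fun x => decide (x ≤ l))⟩))))))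

/-- `n`-fold composition of a relation. -/
def RelPow {α : Type*} (R : α → α → Prop) : ℕ → α → α → Prop
  | 0, a, b => a = b
  | n + 1, a, b => ∃ x, R a x ∧ RelPow R n x b

/-- The single-arm-uncrowding map `𝒜`. -/
def ArmRel (T T' : HVTab) : Prop :=
  (NoArms T ∧ T' = T) ∨
  (¬ NoArms T ∧ ∃ m : ℕ, RelPow ArmBumpRel m T T' ∧ hsize T' = hsize T + 1 ∧
    ∀ m' U, m' < m → RelPow ArmBumpRel m' T U → hsize U = hsize T)

/-- The single-leg-uncrowding map `ℒ`. -/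
def LegRel (T T' : HVTab) : Prop :=
  (NoLegs T ∧ T' = T) ∨
  (¬ NoLegs T ∧ ∃ m : ℕ, RelPow LegBumpRel m T T' ∧ hsize T' = hsize T + 1 ∧
    ∀ m' U, m' < m → RelPow LegBumpRel m' T U → hsize U = hsize T)

/-- The two kinds of uncrowding operators. -/
inductive Bump : Type
  | A
  | L
  deriving DecidableEq

def BumpRel : Bump → HVTab → HVTab → Prop
  | .A => ArmBumpRel
  | .L => LegBumpRel

/-- `T` has type `f_k^{(ε_k)} ⋯ f_1^{(ε_1)}`; the word is given as the list
`[(f_1, ε_1), …, (f_k, ε_k)]` in order of application. -/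
def HasType : HVTab → List (Bump × ℕ) → Prop
  | _, [] => True
  | T, (f, e) :: w => ∃ T', BumpRel f T T' ∧ hsize T' = hsize T + e ∧ HasType T' w

def StepRel : Bump → HVTab → HVTab → Prop
  | .A => ArmRel
  | .L => LegRel

def SelectedArmCol (T : HVTab) (c : ℕ) : Prop := ∃ r a, SelectedArm T r c a
def SelectedLegRow (T : HVTab) (r : ℕ) : Prop := ∃ c l, SelectedLeg T r c l

/-- The recorded entry of one uncrowding step applied to `T`. -/
def StepEntry : Bump → HVTab → MEntry → Prop
  | .A, T, e => ∃ c : ℕ, SelectedArmCol T c ∧ e = MEntry.al (c : ℤ)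
  | .L, T, e => ∃ r : ℕ, SelectedLegRow T r ∧ e = MEntry.be (r : ℤ)

/-- `UncrowdRec w T P Q` means `𝒰_w(T) = (P, Q)`, where `w` is the word listed
in order of application. -/
def UncrowdRec : List Bump → HVTab → HVTab → MixedTableau → Prop
  | [], T, P, Q => P = T ∧ ∀ c, Q c = none
  | f :: w, T, P, Q => ∃ T' Q', StepRel f T T' ∧ UncrowdRec w T' P Q' ∧
      (∀ cell, cell ∈ hshape T' → cell ∉ hshape T →
        ∃ e, StepEntry f T e ∧ Q cell = some e) ∧
      (∀ cell, ¬ (cell ∈ hshape T' ∧ cell ∉ hshape T) → Q cell = Q' cell)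

/-- `𝒰_{ℒ^∞𝒜^∞}(T) = (P, Q)`. -/
def UncrowdLAinf (T P : HVTab) (Q : MixedTableau) : Prop :=
  ∃ M N : ℕ, UncrowdRec (List.replicate M Bump.A ++ List.replicate N Bump.L) T P Q ∧
    NoArms P ∧ NoLegs P

/-- `𝒰_{𝒜^∞ℒ^∞}(T) = (P, Q)`. -/
def UncrowdALinf (T P : HVTab) (Q : MixedTableau) : Prop :=
  ∃ M N : ℕ, UncrowdRec (List.replicate N Bump.L ++ List.replicate M Bump.A) T P Q ∧
    NoArms P ∧ NoLegs P

/-- A semistandard Young tableau, seen as a hook-valued tableau all of whose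
hooks have no arm and no leg entries. -/
def IsSSYT (P : HVTab) : Prop := IsHVT P ∧ NoArms P ∧ NoLegs P

/-- Number of arm entries in column `j` of `T`: the exponent of `α_j` in `wt(T)`. -/
noncomputable def armCountCol (T : HVTab) (j : ℕ) : ℕ := ∑ᶠ i : ℕ, (armsAt T (i, j)).length

/-- Number of leg entries in row `i` of `T`: the exponent of `β_i` in `wt(T)`. -/
noncomputable def legCountRow (T : HVTab) (i : ℕ) : ℕ := ∑ᶠ j : ℕ, (legsAt T (i, j)).length

/-- Number of entries of `T` equal to `v`: the exponent of `x_v` in `wt(T)`. -/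
noncomputable def entryCount (T : HVTab) (v : ℕ) : ℕ := ∑ᶠ c : Cell, (hentriesAt T c).count v

noncomputable def armCountColZ (T : HVTab) (k : ℤ) : ℕ :=
  if 0 ≤ k then armCountCol T k.toNat else 0

noncomputable def legCountRowZ (T : HVTab) (k : ℤ) : ℕ :=
  if 0 ≤ k then legCountRow T k.toNat else 0

/-- `wt(T) = wt(P) · wt(Q)` for a hook-valued tableau `T`, a semistandard
Young tableau `P` (as a hook-valued tableau) and a mixed tableau `Q`. -/
def WtEq (T P : HVTab) (Q : MixedTableau) : Prop :=
  (∀ j : ℕ, armCountCol T j = mcount Q (MEntry.al (j : ℤ))) ∧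
  (∀ i : ℕ, legCountRow T i = mcount Q (MEntry.be (i : ℤ))) ∧
  (∀ k : ℤ, k ≤ 0 → mcount Q (MEntry.al k) = 0 ∧ mcount Q (MEntry.be k) = 0) ∧
  (∀ v : ℕ, entryCount T v = entryCount P v)

namespace GGJdt

/-- The index, after applying `c_β^+`, of the entry `e` placed in the cell `(i, j)`. -/
def shiftedIdx (i j : ℕ) : MEntry → ℤ
  | .al r => r
  | .be s => s + j - i

@[simp] theorem shiftedIdx_al (i j : ℕ) (r : ℤ) : shiftedIdx i j (.al r) = r := rfl

@[simp] theorem shiftedIdx_be (i j : ℕ) (s : ℤ) : shiftedIdx i j (.be s) = s + j - i := rfl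

/-- The cell `(i, j)` and its right neighbour are in order after applying `c_β^+`. -/
def RowOrdered (T : MixedTableau) (i j : ℕ) : Prop :=
  ∀ e e', T (i, j) = some e → T (i, j + 1) = some e' →
    shiftedIdx i (j + 1) e' ≤ shiftedIdx i j e

/-- The cell `(i, j)` and its upper neighbour are in order after applying `c_β^+`. -/
def ColOrdered (T : MixedTableau) (i j : ℕ) : Prop :=
  ∀ e e', T (i, j) = some e → T (i + 1, j) = some e' →
    shiftedIdx (i + 1) j e' < shiftedIdx i j e

theorem cBetaPlus_apply_eq_some {T : MixedTableau} {i j : ℕ} {e : MEntry} (h : T (i, j) = some e) :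
    ∃ e', cBetaPlus T (i, j) = some e' ∧ e'.idx = shiftedIdx i j e := by
  rcases e with k | k
  · exact ⟨.al k, by simp [cBetaPlus, h], rfl⟩
  · refine ⟨.be (k + ((j : ℤ) - (i : ℤ))), by simp [cBetaPlus, h], ?_⟩
    simp [MEntry.idx]
    ring

theorem exists_of_cBetaPlus_eq_some {T : MixedTableau} {i j : ℕ} {e : MEntry}
    (h : cBetaPlus T (i, j) = some e) : ∃ e', T (i, j) = some e' ∧ e.idx = shiftedIdx i j e' := by
  cases hT : T (i, j) with
  | none => simp [cBetaPlus, hT] at h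
  | some e' =>
    obtain ⟨e'', h1, h2⟩ := cBetaPlus_apply_eq_some hT
    rw [h] at h1
    cases h1
    exact ⟨e', rfl, h2⟩

theorem totallyColumnStrict_cBetaPlus_iff {T : MixedTableau} :
    TotallyColumnStrict (cBetaPlus T) ↔ ∀ i j, RowOrdered T i j ∧ ColOrdered T i j := by
  constructor
  · rintro ⟨h1, h2⟩ i j
    refine ⟨fun e e' he he' => ?_, fun e e' he he' => ?_⟩
    · obtain ⟨f, hf, hf'⟩ := cBetaPlus_apply_eq_some he
      obtain ⟨g, hg, hg'⟩ := cBetaPlus_apply_eq_some he'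
      rw [← hf', ← hg']
      exact h2 _ _ _ hf hg
    · obtain ⟨f, hf, hf'⟩ := cBetaPlus_apply_eq_some he
      obtain ⟨g, hg, hg'⟩ := cBetaPlus_apply_eq_some he'
      rw [← hf', ← hg']
      exact h1 _ _ _ hf hg
  · intro h
    refine ⟨fun c e e' he he' => ?_, fun c e e' he he' => ?_⟩
    · obtain ⟨f, hf, hf'⟩ := exists_of_cBetaPlus_eq_some (i := c.1) (j := c.2) he
      obtain ⟨g, hg, hg'⟩ := exists_of_cBetaPlus_eq_some he'
      rw [hf', hg']
      exact (h _ _).2 _ _ hf hg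
    · obtain ⟨f, hf, hf'⟩ := exists_of_cBetaPlus_eq_some (i := c.1) (j := c.2) he
      obtain ⟨g, hg, hg'⟩ := exists_of_cBetaPlus_eq_some he'
      rw [hf', hg']
      exact (h _ _).1 _ _ hf hg

theorem swapCells_apply (T : MixedTableau) (c c' d : Cell) :
    swapCells T c c' d = if d = c' then T c else if d = c then T c' else T d := by
  simp [swapCells, Function.update_apply]

theorem swapCells_swapCells (T : MixedTableau) (c c' : Cell) :
    swapCells (swapCells T c c') c c' = T := by
  funext d
  simp only [swapCells_apply]
  split_ifs <;> simp_all

theorem swapCells_comm (T : MixedTableau) (c c' : Cell) : swapCells T c c' = swapCells T c' c := by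
  funext d
  simp only [swapCells_apply]
  split_ifs <;> simp_all

/-- `nu / lam` is a sorted part of `T` whose `α` entries have not been moved yet. -/
structure Base (lam mu nu : Set Cell) (T : MixedTableau) : Prop where
  lam_shape : IsPartitionShape lam
  mu_shape : IsPartitionShape mu
  nu_shape : IsPartitionShape nu
  lam_sub : lam ⊆ nu
  nu_sub : nu ⊆ mu
  filled : mshape T = mu \ lam
  pos : ∀ c k, T c = some (.al k) → 0 < k
  alpha : ∀ c ∈ nu, c ∉ lam → ∃ k, T c = some (.al k)
  anti : ∀ i j i' j' k k', (i', j') ∈ nu → i ≤ i' → j ≤ j' → T (i, j) = some (.al k) →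
    T (i', j') = some (.al k') → k' ≤ k ∧ (j = j' → i ≠ i' → k ≠ k')
  sep : ∀ c c' k k', c ∈ nu → c' ∉ nu → T c = some (.al k) → T c' = some (.al k') →
    k' ≤ k ∧ (k' = k → c.2 < c'.2)

/-- A state in which everything outside `nu` is in order. -/
structure Settled (lam mu nu : Set Cell) (T : MixedTableau) : Prop extends Base lam mu nu T where
  row : ∀ i j, (i, j) ∉ nu → RowOrdered T i j
  col : ∀ i j, (i, j) ∉ nu → ColOrdered T i j

/-- A state in which the entry `α_r` at `(a, b)` is being moved. -/
structure Sliding (lam mu nu : Set Cell) (a b : ℕ) (r : ℤ) (T : MixedTableau) : Prop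
    extends Base lam mu nu T where
  notMem : (a, b) ∉ nu
  cur : T (a, b) = some (.al r)
  row : ∀ i j, (i, j) ∉ nu → (i, j) ≠ (a, b) → RowOrdered T i j
  col : ∀ i j, (i, j) ∉ nu → (i, j) ≠ (a, b) → ColOrdered T i j
  row_jump : ∀ b' l s, b = b' + 1 → T (a, b') = some (.be l) → T (a, b + 1) = some (.be s) → s < l
  col_jump : ∀ a' d t, a = a' + 1 → T (a', b) = some (.be d) → T (a + 1, b) = some (.be t) → t ≤ d
  max : ∀ c k, c ∉ nu → c ≠ (a, b) → T c = some (.al k) → k ≤ r ∧ (k = r → b < c.2)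

namespace Base

variable {lam mu nu : Set Cell} {T : MixedTableau}

theorem mem (h : Base lam mu nu T) {i j : ℕ} {e : MEntry} (he : T (i, j) = some e) :
    (i, j) ∈ mu ∧ (i, j) ∉ lam ∧ 1 ≤ i ∧ 1 ≤ j := by
  have h1 : (i, j) ∈ mshape T := by simp [mshape, he]
  rw [h.filled] at h1
  exact ⟨h1.1, h1.2, h.mu_shape.2.1 _ h1.1⟩

theorem exists_entry (h : Base lam mu nu T) {i j : ℕ} (h1 : (i, j) ∈ mu) (h2 : (i, j) ∉ nu) :
    ∃ e, T (i, j) = some e := by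
  have h3 : (i, j) ∈ mshape T := by
    rw [h.filled]
    exact ⟨h1, fun h3 => h2 (h.lam_sub h3)⟩
  exact Option.ne_none_iff_exists'.1 h3

theorem notMem_of_le (h : Base lam mu nu T) {i j i' j' : ℕ} (h1 : (i, j) ∉ nu) (hi : 1 ≤ i)
    (hj : 1 ≤ j) (hi' : i ≤ i') (hj' : j ≤ j') : (i', j') ∉ nu :=
  fun h2 => h1 (h.nu_shape.2.2 _ _ _ _ h2 hi hi' hj hj')

theorem notMem_of_beta (h : Base lam mu nu T) {i j : ℕ} {s : ℤ} (he : T (i, j) = some (.be s)) :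
    (i, j) ∉ nu := by
  intro h1
  obtain ⟨k, hk⟩ := h.alpha _ h1 (h.mem he).2.1
  simp [he] at hk

/-- The fourth corner of a unit square, from its upper right and lower left corners. -/
theorem exists_corner (h : Base lam mu nu T) {i j i' j' : ℕ} {e e' : MEntry} (h1 : (i, j) ∉ nu)
    (he : T (i, j) = some e) (he' : T (i', j') = some e') {p q : ℕ} (hp : i ≤ p) (hq : j ≤ q)
    (hp' : p ≤ i') (hq' : q ≤ j') : (p, q) ∉ nu ∧ ∃ f, T (p, q) = some f := by
  have m := h.mem he
  have h2 := h.notMem_of_le h1 m.2.2.1 m.2.2.2 hp hq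
  exact ⟨h2, h.exists_entry (h.mu_shape.2.2 _ _ _ _ (h.mem he').1 (by omega) hp' (by omega) hq') h2⟩

theorem swap (h : Base lam mu nu T) {x y : Cell} {r s : ℤ} (hx : x ∉ nu) (hy : y ∉ nu)
    (hTx : T x = some (.al r)) (hTy : T y = some (.be s))
    (hcol : ∀ c ∈ nu, T c = some (.al r) → c.2 < y.2) : Base lam mu nu (swapCells T x y) := by
  have hout : ∀ c ∈ nu, swapCells T x y c = T c := by
    intro c hc
    rw [swapCells_apply, if_neg (by rintro rfl; exact hy hc), if_neg (by rintro rfl; exact hx hc)]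
  have hal : ∀ c k, swapCells T x y c = some (.al k) → (c = y ∧ k = r) ∨ T c = some (.al k) := by
    intro c k hc
    rw [swapCells_apply] at hc
    split_ifs at hc with h1 h2
    · exact Or.inl ⟨h1, by simp_all⟩
    · simp_all
    · exact Or.inr hc
  refine ⟨h.lam_shape, h.mu_shape, h.nu_shape, h.lam_sub, h.nu_sub, ?_, ?_, ?_, ?_, ?_⟩
  · rw [← h.filled]
    ext c
    simp only [mshape, Set.mem_ofPred_eq, swapCells_apply]
    split_ifs <;> simp_all
  · intro c k hc
    rcases hal c k hc with ⟨-, rfl⟩ | h1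
    exacts [h.pos _ _ hTx, h.pos _ _ h1]
  · intro c hc hc'
    rw [hout c hc]
    exact h.alpha c hc hc'
  · intro i j i' j' k k' h1 h2 h3 h4 h5
    rw [hout _ h1] at h5
    have h6 : (i, j) ∈ nu := by
      by_contra hn
      have : 1 ≤ i ∧ 1 ≤ j := by
        rcases hal _ _ h4 with ⟨h7, -⟩ | h7
        · rw [← h7] at hTy
          exact (h.mem hTy).2.2
        · exact (h.mem h7).2.2
      exact h.notMem_of_le hn this.1 this.2 h2 h3 h1
    rw [hout _ h6] at h4
    exact h.anti _ _ _ _ _ _ h1 h2 h3 h4 h5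
  · intro c c' k k' h1 h2 h3 h4
    rw [hout _ h1] at h3
    rcases hal _ _ h4 with ⟨rfl, rfl⟩ | h5
    · refine ⟨(h.sep _ _ _ _ h1 hx h3 hTx).1, ?_⟩
      rintro rfl
      exact hcol _ h1 h3
    · exact h.sep _ _ _ _ h1 h2 h3 h5

end Base

/-- The entry at `(a, b)` is out of order and moves to the right. -/
def MovesRight (T : MixedTableau) (a b : ℕ) (r s : ℤ) : Prop :=
  T (a, b + 1) = some (.be s) ∧ r < s + (b + 1) - a ∧
    ∀ t, T (a + 1, b) = some (.be t) → r ≤ t + b - (a + 1) → t ≤ s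

/-- The entry at `(a, b)` is out of order and moves up. -/
def MovesUp (T : MixedTableau) (a b : ℕ) (r t : ℤ) : Prop :=
  T (a + 1, b) = some (.be t) ∧ r ≤ t + b - (a + 1) ∧
    ∀ s, T (a, b + 1) = some (.be s) → r < s + (b + 1) - a → s < t

/-- The `β` entry to the left of `(a, b + 1)` moves right when the slide is reversed. -/
def ReversesLeft (T : MixedTableau) (a b : ℕ) (l : ℤ) : Prop :=
  T (a, b) = some (.be l) ∧ ∀ a' d, a = a' + 1 → T (a', b + 1) = some (.be d) → l ≤ d

/-- The `β` entry below `(a + 1, b)` moves up when the slide is reversed. -/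
def ReversesDown (T : MixedTableau) (a b : ℕ) (d : ℤ) : Prop :=
  T (a, b) = some (.be d) ∧ ∀ b' l, b = b' + 1 → T (a + 1, b') = some (.be l) → d < l

theorem swapCells_of_ne (T : MixedTableau) {c c' d : Cell} (h : d ≠ c) (h' : d ≠ c') :
    swapCells T c c' d = T d := by
  rw [swapCells_apply, if_neg h', if_neg h]

theorem swapCells_left (T : MixedTableau) (c c' : Cell) : swapCells T c c' c = T c' := by
  rw [swapCells_comm, swapCells_apply, if_pos rfl]

theorem swapCells_right (T : MixedTableau) (c c' : Cell) : swapCells T c c' c' = T c := by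
  rw [swapCells_apply, if_pos rfl]

namespace Sliding

variable {lam mu nu : Set Cell} {T : MixedTableau} {a b : ℕ} {r : ℤ}

theorem swapped_alpha {x y c : Cell} {k s : ℤ} (hy : T y = some (.be s))
    (hne : c ≠ y) (hc : swapCells T x y c = some (.al k)) : c ≠ x ∧ T c = some (.al k) := by
  by_cases h : c = x
  · subst h
    rw [swapCells_left, hy] at hc
    simp at hc
  · rw [swapCells_of_ne _ h hne] at hc
    exact ⟨h, hc⟩

/-- Inequalities between `α` entries and the moving one. -/
theorem alpha_le (h : Sliding lam mu nu a b r T) {c : Cell} {k : ℤ} (hc : c ∉ nu)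
    (hk : T c = some (.al k)) : k ≤ r := by
  by_cases hne : c = (a, b)
  · subst hne
    rw [h.cur] at hk
    cases hk
    exact le_rfl
  · exact (h.max c k hc hne hk).1

theorem right (h : Sliding lam mu nu a b r T) {s : ℤ} (hs : MovesRight T a b r s)
    (hcol : ∀ c, c ∉ nu → c ≠ (a, b) → T c = some (.al r) → b + 1 < c.2) :
    Sliding lam mu nu a (b + 1) r (swapCells T (a, b) (a, b + 1)) := by
  obtain ⟨hs, hrs, hup⟩ := hs
  have hn := h.notMem_of_beta hs
  have m := h.mem h.cur
  refine ⟨h.toBase.swap h.notMem hn h.cur hs ?_, hn, by rw [swapCells_right, h.cur],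
    ?_, ?_, ?_, ?_, ?_⟩
  · intro c hc hc'
    have := (h.sep _ _ _ _ hc h.notMem hc' h.cur).2 rfl
    simp only at this ⊢
    omega
  · intro i j hij hne e e' he he'
    by_cases h1 : i = a ∧ j = b
    · obtain ⟨rfl, rfl⟩ := h1
      rw [swapCells_left, hs] at he
      rw [swapCells_right, h.cur] at he'
      cases he; cases he'
      simp
      omega
    by_cases h2 : i = a ∧ j + 1 = b
    · obtain ⟨rfl, rfl⟩ := h2
      rw [swapCells_of_ne _ (by simp) (by simp; omega)] at he
      rw [swapCells_left, hs] at he'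
      cases he'
      have hE := h.row _ _ hij (by simp) _ _ he h.cur
      rcases e with k | l
      · have := h.max _ _ hij (by simp) he
        simp at this hE
        omega
      · have := h.row_jump _ _ _ rfl he hs
        simp
        omega
    simp only [Prod.mk.injEq, ne_eq] at hne
    rw [swapCells_of_ne _ (by simp; omega) (by simp; omega)] at he he'
    exact h.row i j hij (by simp; omega) _ _ he he'
  · intro i j hij hne e e' he he'
    by_cases h1 : i = a ∧ j = b
    · obtain ⟨rfl, rfl⟩ := h1
      rw [swapCells_left, hs] at he
      rw [swapCells_of_ne _ (by simp) (by simp)] at he'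
      cases he
      rcases e' with k | t
      · have := h.max _ _ (h.notMem_of_le hij m.2.2.1 m.2.2.2 (by omega) le_rfl)
          (by simp) he'
        simp at this ⊢
        omega
      · have := hup _ he'
        simp
        omega
    by_cases h2 : i + 1 = a ∧ j = b
    · obtain ⟨rfl, rfl⟩ := h2
      rw [swapCells_of_ne _ (by simp) (by simp)] at he
      rw [swapCells_left, hs] at he'
      cases he'
      obtain ⟨hf, f, hf'⟩ := h.exists_corner hij he hs (p := i) (q := j + 1)
        le_rfl (by omega) (by omega) le_rfl
      have h3 := h.row _ _ hij (by simp) _ _ he hf'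
      have h4 := h.col _ _ hf (by simp) _ _ hf' hs
      simp at h4 ⊢
      omega
    by_cases h3 : i + 1 = a ∧ j = b + 1
    · obtain ⟨rfl, rfl⟩ := h3
      rw [swapCells_of_ne _ (by simp) (by simp)] at he
      rw [swapCells_right, h.cur] at he'
      cases he'
      have := h.col _ _ hij (by simp) _ _ he hs
      simp at this ⊢
      omega
    simp only [Prod.mk.injEq, ne_eq] at hne
    rw [swapCells_of_ne _ (by simp; omega) (by simp; omega)] at he he'
    exact h.col i j hij (by simp; omega) _ _ he he'
  · intro b' l s' hb hl hs'
    obtain rfl : b = b' := by omega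
    rw [swapCells_left, hs] at hl
    rw [swapCells_of_ne _ (by simp; omega) (by simp)] at hs'
    cases hl
    have := h.row _ _ hn (by simp) _ _ hs hs'
    simp at this
    omega
  · intro a' d t ha hd ht
    subst ha
    rw [swapCells_of_ne _ (by simp) (by simp)] at hd ht
    have h1 := h.col _ _ hn (by simp) _ _ hs ht
    have h2 := h.col _ _ (h.notMem_of_beta hd) (by simp) _ _ hd hs
    simp at h1 h2
    omega
  · intro c k hc hne hk
    obtain ⟨h1, h2⟩ := swapped_alpha hs hne hk
    refine ⟨(h.max c k hc h1 h2).1, ?_⟩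
    rintro rfl
    exact hcol c hc h1 h2

theorem up (h : Sliding lam mu nu a b r T) {t : ℤ} (ht : MovesUp T a b r t) :
    Sliding lam mu nu (a + 1) b r (swapCells T (a, b) (a + 1, b)) := by
  obtain ⟨ht, hrt, hright⟩ := ht
  have hn := h.notMem_of_beta ht
  have m := h.mem h.cur
  refine ⟨h.toBase.swap h.notMem hn h.cur ht ?_, hn, by rw [swapCells_right, h.cur],
    ?_, ?_, ?_, ?_, ?_⟩
  · intro c hc hc'
    exact (h.sep _ _ _ _ hc h.notMem hc' h.cur).2 rfl
  · intro i j hij hne e e' he he'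
    by_cases h1 : i = a ∧ j = b
    · obtain ⟨rfl, rfl⟩ := h1
      rw [swapCells_left, ht] at he
      rw [swapCells_of_ne _ (by simp) (by simp)] at he'
      cases he
      rcases e' with k | s
      · have := h.alpha_le (h.notMem_of_le hij m.2.2.1 m.2.2.2 le_rfl (by omega)) he'
        simp
        omega
      · have := hright _ he'
        simp
        omega
    by_cases h2 : i = a ∧ j + 1 = b
    · obtain ⟨rfl, rfl⟩ := h2
      rw [swapCells_of_ne _ (by simp) (by simp)] at he
      rw [swapCells_left, ht] at he'
      cases he'
      obtain ⟨hf, f, hf'⟩ := h.exists_corner hij he ht (p := i + 1) (q := j)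
        (by omega) le_rfl le_rfl (by omega)
      have h3 := h.col _ _ hij (by simp) _ _ he hf'
      have h4 := h.row _ _ hf (by simp) _ _ hf' ht
      simp at h4 ⊢
      omega
    by_cases h3 : i = a + 1 ∧ j + 1 = b
    · obtain ⟨rfl, rfl⟩ := h3
      rw [swapCells_of_ne _ (by simp) (by simp)] at he
      rw [swapCells_right, h.cur] at he'
      cases he'
      have := h.row _ _ hij (by simp) _ _ he ht
      simp at this ⊢
      omega
    simp only [Prod.mk.injEq, ne_eq] at hne
    rw [swapCells_of_ne _ (by simp; omega) (by simp; omega)] at he he'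
    exact h.row i j hij (by simp; omega) _ _ he he'
  · intro i j hij hne e e' he he'
    by_cases h1 : i = a ∧ j = b
    · obtain ⟨rfl, rfl⟩ := h1
      rw [swapCells_left, ht] at he
      rw [swapCells_right, h.cur] at he'
      cases he; cases he'
      simp
      omega
    by_cases h2 : i + 1 = a ∧ j = b
    · obtain ⟨rfl, rfl⟩ := h2
      rw [swapCells_of_ne _ (by simp) (by simp; omega)] at he
      rw [swapCells_left, ht] at he'
      cases he'
      have hE := h.col _ _ hij (by simp) _ _ he h.cur
      rcases e with k | d
      · have := h.max _ _ hij (by simp) he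
        simp at this hE
        omega
      · have := h.col_jump _ _ _ rfl he ht
        simp
        omega
    simp only [Prod.mk.injEq, ne_eq] at hne
    rw [swapCells_of_ne _ (by simp; omega) (by simp; omega)] at he he'
    exact h.col i j hij (by simp; omega) _ _ he he'
  · intro b' l s hb hl hs
    subst hb
    rw [swapCells_of_ne _ (by simp) (by simp)] at hl hs
    have h1 := h.row _ _ hn (by simp) _ _ ht hs
    have h2 := h.row _ _ (h.notMem_of_beta hl) (by simp) _ _ hl ht
    simp at h1 h2
    omega
  · intro a' d t' ha hd ht'
    obtain rfl : a = a' := by omega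
    rw [swapCells_left, ht] at hd
    rw [swapCells_of_ne _ (by simp; omega) (by simp)] at ht'
    cases hd
    have := h.col _ _ hn (by simp) _ _ ht ht'
    simp at this
    omega
  · intro c k hc hne hk
    obtain ⟨h1, h2⟩ := swapped_alpha ht hne hk
    exact h.max c k hc h1 h2

theorem left (h : Sliding lam mu nu a (b + 1) r T) {l : ℤ} (hl : ReversesLeft T a b l)
    (hcol : ∀ c ∈ nu, T c = some (.al r) → c.2 < b) :
    Sliding lam mu nu a b r (swapCells T (a, b + 1) (a, b)) := by
  obtain ⟨hl, hdown⟩ := hl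
  have hn := h.notMem_of_beta hl
  have m := h.mem hl
  have hrl := h.row _ _ hn (by simp) _ _ hl h.cur
  simp at hrl
  refine ⟨h.toBase.swap h.notMem hn h.cur hl hcol, hn, by rw [swapCells_right, h.cur],
    ?_, ?_, ?_, ?_, ?_⟩
  · intro i j hij hne e e' he he'
    by_cases h1 : i = a ∧ j = b + 1
    · obtain ⟨rfl, rfl⟩ := h1
      rw [swapCells_left, hl] at he
      rw [swapCells_of_ne _ (by simp) (by simp; omega)] at he'
      cases he
      rcases e' with k | s
      · have := h.alpha_le (h.notMem_of_le hij (by omega) (by omega) le_rfl (by omega)) he'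
        simp
        omega
      · have := h.row_jump _ _ _ rfl hl he'
        simp
        omega
    by_cases h2 : i = a ∧ j + 1 = b
    · obtain ⟨rfl, rfl⟩ := h2
      rw [swapCells_of_ne _ (by simp; omega) (by simp)] at he
      rw [swapCells_right, h.cur] at he'
      cases he'
      have := h.row _ _ hij (by simp; omega) _ _ he hl
      simp at this ⊢
      omega
    simp only [Prod.mk.injEq, ne_eq] at hne
    rw [swapCells_of_ne _ (by simp; omega) (by simp; omega)] at he he'
    exact h.row i j hij (by simp; omega) _ _ he he'
  · intro i j hij hne e e' he he'
    by_cases h1 : i = a ∧ j = b + 1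
    · obtain ⟨rfl, rfl⟩ := h1
      rw [swapCells_left, hl] at he
      rw [swapCells_of_ne _ (by simp) (by simp)] at he'
      cases he
      obtain ⟨hf, f, hf'⟩ := h.exists_corner hn hl he' (p := i + 1) (q := b)
        (by omega) le_rfl le_rfl (by omega)
      have h3 := h.col _ _ hn (by simp) _ _ hl hf'
      have h4 := h.row _ _ hf (by simp) _ _ hf' he'
      simp at h3 ⊢
      omega
    by_cases h2 : i + 1 = a ∧ j = b
    · obtain ⟨rfl, rfl⟩ := h2
      rw [swapCells_of_ne _ (by simp) (by simp)] at he
      rw [swapCells_right, h.cur] at he'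
      cases he'
      have := h.col _ _ hij (by simp) _ _ he hl
      simp at this ⊢
      omega
    by_cases h3 : i + 1 = a ∧ j = b + 1
    · obtain ⟨rfl, rfl⟩ := h3
      rw [swapCells_of_ne _ (by simp) (by simp)] at he
      rw [swapCells_left, hl] at he'
      cases he'
      have hE := h.col _ _ hij (by simp) _ _ he h.cur
      rcases e with k | d
      · have := h.alpha_le hij he
        simp at hE
        omega
      · have := hdown _ _ rfl he
        simp
        omega
    simp only [Prod.mk.injEq, ne_eq] at hne
    rw [swapCells_of_ne _ (by simp; omega) (by simp; omega)] at he he'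
    exact h.col i j hij (by simp; omega) _ _ he he'
  · intro b' l' s hb hl' hs
    subst hb
    rw [swapCells_left, hl] at hs
    rw [swapCells_of_ne _ (by simp; omega) (by simp)] at hl'
    cases hs
    have := h.row _ _ (h.notMem_of_beta hl') (by simp; omega) _ _ hl' hl
    simp at this
    omega
  · intro a' d t ha hd ht
    subst ha
    rw [swapCells_of_ne _ (by simp) (by simp)] at hd ht
    have h1 := h.col _ _ hn (by simp) _ _ hl ht
    have h2 := h.col _ _ (h.notMem_of_beta hd) (by simp) _ _ hd hl
    simp at h1 h2
    omega
  · intro c k hc hne hk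
    obtain ⟨h1, h2⟩ := swapped_alpha hl hne hk
    have := h.max c k hc h1 h2
    exact ⟨this.1, fun h3 => by have := this.2 h3; omega⟩

theorem down (h : Sliding lam mu nu (a + 1) b r T) {d : ℤ} (hd : ReversesDown T a b d) :
    Sliding lam mu nu a b r (swapCells T (a + 1, b) (a, b)) := by
  obtain ⟨hd, hleft⟩ := hd
  have hn := h.notMem_of_beta hd
  have m := h.mem hd
  have hrd := h.col _ _ hn (by simp) _ _ hd h.cur
  simp at hrd
  refine ⟨h.toBase.swap h.notMem hn h.cur hd ?_, hn, by rw [swapCells_right, h.cur],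
    ?_, ?_, ?_, ?_, ?_⟩
  · intro c hc hc'
    exact (h.sep _ _ _ _ hc h.notMem hc' h.cur).2 rfl
  · intro i j hij hne e e' he he'
    by_cases h1 : i = a + 1 ∧ j = b
    · obtain ⟨rfl, rfl⟩ := h1
      rw [swapCells_left, hd] at he
      rw [swapCells_of_ne _ (by simp) (by simp)] at he'
      cases he
      obtain ⟨hf, f, hf'⟩ := h.exists_corner hn hd he' (p := a) (q := j + 1)
        le_rfl (by omega) (by omega) le_rfl
      have h3 := h.row _ _ hn (by simp) _ _ hd hf'
      have h4 := h.col _ _ hf (by simp) _ _ hf' he'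
      simp at h3 ⊢
      omega
    by_cases h2 : i = a ∧ j + 1 = b
    · obtain ⟨rfl, rfl⟩ := h2
      rw [swapCells_of_ne _ (by simp) (by simp)] at he
      rw [swapCells_right, h.cur] at he'
      cases he'
      have := h.row _ _ hij (by simp) _ _ he hd
      simp at this ⊢
      omega
    by_cases h3 : i = a + 1 ∧ j + 1 = b
    · obtain ⟨rfl, rfl⟩ := h3
      rw [swapCells_of_ne _ (by simp) (by simp)] at he
      rw [swapCells_left, hd] at he'
      cases he'
      have hE := h.row _ _ hij (by simp) _ _ he h.cur
      rcases e with k | l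
      · have := h.max _ _ hij (by simp) he
        simp at hE this
        omega
      · have := hleft _ _ rfl he
        simp
        omega
    simp only [Prod.mk.injEq, ne_eq] at hne
    rw [swapCells_of_ne _ (by simp; omega) (by simp; omega)] at he he'
    exact h.row i j hij (by simp; omega) _ _ he he'
  · intro i j hij hne e e' he he'
    by_cases h1 : i = a + 1 ∧ j = b
    · obtain ⟨rfl, rfl⟩ := h1
      rw [swapCells_left, hd] at he
      rw [swapCells_of_ne _ (by simp) (by simp; omega)] at he'
      cases he
      rcases e' with k | s
      · have := h.max _ _ (h.notMem_of_le hij (by omega) (by omega) (by omega) le_rfl)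
          (by simp) he'
        simp at this ⊢
        omega
      · have := h.col_jump _ _ _ rfl hd he'
        simp
        omega
    by_cases h2 : i + 1 = a ∧ j = b
    · obtain ⟨rfl, rfl⟩ := h2
      rw [swapCells_of_ne _ (by simp; omega) (by simp)] at he
      rw [swapCells_right, h.cur] at he'
      cases he'
      have := h.col _ _ hij (by simp; omega) _ _ he hd
      simp at this ⊢
      omega
    simp only [Prod.mk.injEq, ne_eq] at hne
    rw [swapCells_of_ne _ (by simp; omega) (by simp; omega)] at he he'
    exact h.col i j hij (by simp; omega) _ _ he he'
  · intro b' l s hb hl hs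
    subst hb
    rw [swapCells_of_ne _ (by simp) (by simp)] at hl hs
    have h1 := h.row _ _ hn (by simp) _ _ hd hs
    have h2 := h.row _ _ (h.notMem_of_beta hl) (by simp) _ _ hl hd
    simp at h1 h2
    omega
  · intro a' d' t ha hd' ht
    subst ha
    rw [swapCells_left, hd] at ht
    rw [swapCells_of_ne _ (by simp; omega) (by simp)] at hd'
    cases ht
    have := h.col _ _ (h.notMem_of_beta hd') (by simp; omega) _ _ hd' hd
    simp at this
    omega
  · intro c k hc hne hk
    obtain ⟨h1, h2⟩ := swapped_alpha hd hne hk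
    exact h.max c k hc h1 h2

end Sliding

section Slides

variable {lam mu nu : Set Cell} {T T' T'' : MixedTableau} {a b : ℕ} {r s t : ℤ}

theorem outOfOrderH_iff (h : T (a, b) = some (.al r)) :
    OutOfOrderH T (a, b) ↔ ∃ s, T (a, b + 1) = some (.be s) ∧ r < s + (b + 1) - a := by
  simp [OutOfOrderH, rtCell, h]

theorem outOfOrderV_iff (h : T (a, b) = some (.al r)) :
    OutOfOrderV T (a, b) ↔ ∃ t, T (a + 1, b) = some (.be t) ∧ r ≤ t + b - (a + 1) := by
  simp [OutOfOrderV, upCell, h]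

theorem ggSlide_iff (h : T (a, b) = some (.al r)) :
    GGSlide T (a, b) T' ↔
      (∃ s, MovesRight T a b r s ∧ T' = swapCells T (a, b) (a, b + 1)) ∨
        ∃ t, MovesUp T a b r t ∧ T' = swapCells T (a, b) (a + 1, b) := by
  rw [GGSlide, outOfOrderH_iff h, outOfOrderV_iff h]
  simp only [rtCell, upCell, MovesRight, MovesUp]
  constructor
  · rintro (⟨⟨s, hs, hrs⟩, hV, rfl⟩ | ⟨⟨t, ht, hrt⟩, hH, rfl⟩ |
      ⟨⟨s, hs, hrs⟩, ⟨t, ht, hrt⟩, s', t', hs', ht', ⟨hst, rfl⟩ | ⟨hst, rfl⟩⟩)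
    · exact .inl ⟨s, ⟨hs, hrs, fun t ht hrt => absurd ⟨t, ht, hrt⟩ hV⟩, rfl⟩
    · exact .inr ⟨t, ⟨ht, hrt, fun s hs hrs => absurd ⟨s, hs, hrs⟩ hH⟩, rfl⟩
    · refine .inl ⟨s, ⟨hs, hrs, fun t'' ht'' _ => ?_⟩, rfl⟩
      simp_all
    · refine .inr ⟨t, ⟨ht, hrt, fun s'' hs'' _ => ?_⟩, rfl⟩
      simp_all
  · rintro (⟨s, ⟨hs, hrs, hst⟩, rfl⟩ | ⟨t, ⟨ht, hrt, hst⟩, rfl⟩)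
    · by_cases hV : ∃ t, T (a + 1, b) = some (.be t) ∧ r ≤ t + b - (a + 1)
      · obtain ⟨t, ht, hrt⟩ := hV
        exact .inr (.inr ⟨⟨s, hs, hrs⟩, ⟨t, ht, hrt⟩, s, t, hs, ht, .inl ⟨hst t ht hrt, rfl⟩⟩)
      · exact .inl ⟨⟨s, hs, hrs⟩, hV, rfl⟩
    · by_cases hH : ∃ s, T (a, b + 1) = some (.be s) ∧ r < s + (b + 1) - a
      · obtain ⟨s, hs, hrs⟩ := hH
        exact .inr (.inr ⟨⟨s, hs, hrs⟩, ⟨t, ht, hrt⟩, s, t, hs, ht, .inr ⟨hst s hs hrs, rfl⟩⟩)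
      · exact .inr (.inl ⟨⟨t, ht, hrt⟩, hH, rfl⟩)

theorem movesRight_or_movesUp (h : T (a, b) = some (.al r)) (ho : OutOfOrder T (a, b)) :
    (∃ s, MovesRight T a b r s) ∨ ∃ t, MovesUp T a b r t := by
  rw [OutOfOrder, outOfOrderH_iff h, outOfOrderV_iff h] at ho
  simp only [MovesRight, MovesUp]
  by_cases hH : ∃ s, T (a, b + 1) = some (.be s) ∧ r < s + (b + 1) - a
  · obtain ⟨s, hs, hrs⟩ := hH
    by_cases hV : ∃ t, T (a + 1, b) = some (.be t) ∧ r ≤ t + b - (a + 1)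
    · obtain ⟨t, ht, hrt⟩ := hV
      rcases le_or_gt t s with hst | hst
      · refine .inl ⟨s, hs, hrs, fun t' ht' _ => ?_⟩
        simp_all
      · refine .inr ⟨t, ht, hrt, fun s' hs' _ => ?_⟩
        simp_all
    · exact .inl ⟨s, hs, hrs, fun t ht hrt => absurd ⟨t, ht, hrt⟩ hV⟩
  · obtain ⟨t, ht, hrt⟩ := ho.resolve_left hH
    exact .inr ⟨t, ht, hrt, fun s hs hrs => absurd ⟨s, hs, hrs⟩ hH⟩

theorem outOfOrder_of_ggSlide {c : Cell} (h : GGSlide T c T') : OutOfOrder T c := by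
  rcases h with ⟨h, -⟩ | ⟨h, -⟩ | ⟨h, -⟩
  exacts [.inl h, .inr h, .inl h]

theorem ggSlide_unique {c : Cell} (h : GGSlide T c T') (h' : GGSlide T c T'') : T' = T'' := by
  unfold GGSlide at h h'
  rcases h with ⟨h1, h2, rfl⟩ | ⟨h1, h2, rfl⟩ | ⟨h1, h2, s, t, hs, ht, h3⟩ <;>
  rcases h' with ⟨h1', h2', rfl⟩ | ⟨h1', h2', rfl⟩ | ⟨h1', h2', s', t', hs', ht', h3'⟩
  any_goals first | rfl | contradiction
  obtain rfl : s = s' := by simpa [hs] using hs'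
  obtain rfl : t = t' := by simpa [ht] using ht'
  rcases h3 with ⟨h3, rfl⟩ | ⟨h3, rfl⟩ <;> rcases h3' with ⟨h3', rfl⟩ | ⟨h3', rfl⟩
  any_goals rfl
  all_goals omega

theorem not_outOfOrder (hrow : RowOrdered T a b) (hcol : ColOrdered T a b) :
    ¬ OutOfOrder T (a, b) := by
  rintro (⟨r, s, h1, h2, h3⟩ | ⟨r, t, h1, h2, h3⟩)
  · have := hrow _ _ h1 h2
    simp at this h3
    omega
  · have := hcol _ _ h1 h2
    simp at this h3
    omega

theorem Sliding.eq_of_outOfOrder (h : Sliding lam mu nu a b r T) {c : Cell} (hc : c ∉ nu)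
    (ho : OutOfOrder T c) : c = (a, b) := by
  by_contra hne
  exact not_outOfOrder (h.row _ _ hc hne) (h.col _ _ hc hne) ho

theorem Sliding.ggChosen (h : Sliding lam mu nu a b r T) (ho : OutOfOrder T (a, b)) :
    GGChosen T (a, b) := by
  refine ⟨r, h.cur, ho, fun c k hk hc => ?_, fun c hk hc => ?_⟩
  · by_cases hn : c ∈ nu
    · exact (h.sep _ _ _ _ hn h.notMem hk h.cur).1
    · rw [h.eq_of_outOfOrder hn hc, h.cur] at hk
      cases hk
      exact le_rfl
  · by_cases hn : c ∈ nu
    · exact ((h.sep _ _ _ _ hn h.notMem hk h.cur).2 rfl).le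
    · rw [h.eq_of_outOfOrder hn hc]

theorem Sliding.ggStep_iff (h : Sliding lam mu nu a b r T) (ho : OutOfOrder T (a, b)) :
    GGStep T T' ↔ GGSlide T (a, b) T' := by
  refine ⟨?_, fun h' => ⟨_, h.ggChosen ho, h'⟩⟩
  rintro ⟨c, ⟨k, hk, hc, hmin, hright⟩, h'⟩
  by_cases hn : c ∈ nu
  · have h1 := h.sep _ _ _ _ hn h.notMem hk h.cur
    have h2 := hmin _ _ h.cur ho
    obtain rfl : r = k := by omega
    have h3 := h1.2 rfl
    have h4 := hright _ h.cur ho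
    omega
  · rwa [h.eq_of_outOfOrder hn hc] at h'

theorem ReversesLeft.movesRight (h : Sliding lam mu nu a (b + 1) r T) {l : ℤ}
    (hl : ReversesLeft T a b l) : MovesRight (swapCells T (a, b + 1) (a, b)) a b r l := by
  have hn := h.notMem_of_beta hl.1
  have hrl := h.row _ _ hn (by simp) _ _ hl.1 h.cur
  simp at hrl
  refine ⟨by rw [swapCells_left, hl.1], by omega, fun t ht _ => ?_⟩
  rw [swapCells_of_ne _ (by simp) (by simp)] at ht
  have h1 := h.col _ _ hn (by simp) _ _ hl.1 ht
  simp at h1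
  omega

theorem ReversesDown.movesUp (h : Sliding lam mu nu (a + 1) b r T) {d : ℤ}
    (hd : ReversesDown T a b d) : MovesUp (swapCells T (a + 1, b) (a, b)) a b r d := by
  have hn := h.notMem_of_beta hd.1
  have hrd := h.col _ _ hn (by simp) _ _ hd.1 h.cur
  simp at hrd
  refine ⟨by rw [swapCells_left, hd.1], by omega, fun s hs _ => ?_⟩
  rw [swapCells_of_ne _ (by simp) (by simp)] at hs
  have h1 := h.row _ _ hn (by simp) _ _ hd.1 hs
  simp at h1
  omega

end Slides

section Settled

variable {lam mu nu : Set Cell} {T : MixedTableau} {a b : ℕ} {r : ℤ}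

theorem Settled.row_chain (h : Settled lam mu nu T) {i j : ℕ} {e : MEntry} (hn : (i, j) ∉ nu)
    (he : T (i, j) = some e) (n : ℕ) {e' : MEntry} (he' : T (i, j + n) = some e') :
    shiftedIdx i (j + n) e' ≤ shiftedIdx i j e := by
  induction n generalizing e' with
  | zero =>
    rw [add_zero, he] at he'
    cases he'
    exact le_rfl
  | succ n ih =>
    obtain ⟨hf, f, hf'⟩ := h.exists_corner hn he he' (p := i) (q := j + n)
      le_rfl (by omega) le_rfl (by omega)
    exact (h.row _ _ hf _ _ hf' he').trans (ih hf')

theorem Settled.col_chain (h : Settled lam mu nu T) {i j : ℕ} {e : MEntry} (hn : (i, j) ∉ nu)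
    (he : T (i, j) = some e) (n : ℕ) {e' : MEntry} (he' : T (i + n, j) = some e') :
    shiftedIdx (i + n) j e' + n ≤ shiftedIdx i j e := by
  induction n generalizing e' with
  | zero =>
    rw [add_zero, he] at he'
    cases he'
    simp
  | succ n ih =>
    obtain ⟨hf, f, hf'⟩ := h.exists_corner hn he he' (p := i + n) (q := j)
      (by omega) le_rfl (by omega) le_rfl
    have h1 := h.col _ _ hf _ _ hf' he'
    have h2 := ih hf'
    rw [add_assoc] at h1
    push_cast
    omega

theorem Settled.alpha_ne_of_lt (h : Settled lam mu nu T) {i i' j : ℕ} (hn : (i, j) ∉ nu)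
    (hlt : i < i') (he : T (i, j) = some (.al r)) : T (i', j) ≠ some (.al r) := by
  intro he'
  obtain ⟨n, rfl⟩ := Nat.exists_eq_add_of_lt hlt
  have := h.col_chain hn he (n + 1) he'
  simp at this
  omega

theorem Sliding.settled (h : Sliding lam mu nu a b r T) (ho : ¬ OutOfOrder T (a, b)) :
    Settled lam mu nu T := by
  have m := h.mem h.cur
  rw [OutOfOrder, outOfOrderH_iff h.cur, outOfOrderV_iff h.cur] at ho
  push Not at ho
  refine ⟨h.toBase, fun i j hij e e' he he' => ?_, fun i j hij e e' he he' => ?_⟩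
  · by_cases hne : (i, j) = (a, b)
    · cases hne
      rw [h.cur] at he
      cases he
      rcases e' with k | s
      · exact h.alpha_le (h.notMem_of_le hij m.2.2.1 m.2.2.2 le_rfl (by omega)) he'
      · simpa using ho.1 s he'
    · exact h.row _ _ hij hne _ _ he he'
  · by_cases hne : (i, j) = (a, b)
    · cases hne
      rw [h.cur] at he
      cases he
      rcases e' with k | s
      · have := h.max _ _ (h.notMem_of_le hij m.2.2.1 m.2.2.2 (by omega) le_rfl) (by simp) he'
        simp at this ⊢
        omega
      · simpa using ho.2 s he'
    · exact h.col _ _ hij hne _ _ he he'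

theorem Settled.exists_sliding_of_ne (h : Settled lam mu nu T) (hne : nu ≠ lam) :
    ∃ nu' a b r, (a, b) ∉ nu' ∧ nu = insert (a, b) nu' ∧ Sliding lam mu nu' a b r T := by
  have hS : (nu \ lam).Nonempty := by
    rw [Set.nonempty_iff_ne_empty, ne_eq, Set.sdiff_eq_empty]
    exact fun h1 => hne (h1.antisymm h.lam_sub)
  obtain ⟨⟨a, b⟩, hp, hmin⟩ := Set.exists_min_image (nu \ lam)
    (fun c => toLex (((T c).elim 0 MEntry.idx : ℤ), -(c.2 : ℤ))) (h.nu_shape.1.sdiff) hS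
  obtain ⟨r, hr⟩ := h.alpha _ hp.1 hp.2
  have hmin' : ∀ c ∈ nu, ∀ k, T c = some (.al k) → r ≤ k ∧ (k = r → c.2 ≤ b) := by
    intro c hc k hk
    have := hmin c ⟨hc, (h.mem hk).2.1⟩
    simp [hk, hr, MEntry.idx, Prod.Lex.toLex_le_toLex] at this
    omega
  have m := h.mem hr
  refine ⟨nu \ {(a, b)}, a, b, r, by simp, by simp [hp.1], ?_⟩
  have hmem : ∀ c, c ∉ nu \ {(a, b)} → c ≠ (a, b) → c ∉ nu := fun c h1 h2 h3 => h1 ⟨h3, h2⟩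
  refine ⟨⟨h.lam_shape, h.mu_shape, ⟨h.nu_shape.1.sdiff, fun c hc => h.nu_shape.2.1 _ hc.1,
    ?_⟩, ?_, Set.sdiff_subset.trans h.nu_sub, h.filled, h.pos, fun c hc => h.alpha c hc.1, ?_, ?_⟩,
    by simp, hr, fun i j hc hc' => h.row _ _ (hmem _ hc hc'),
    fun i j hc hc' => h.col _ _ (hmem _ hc hc'), ?_, ?_, ?_⟩
  · intro i j i' j' hij hi' hi hj' hj
    refine ⟨h.nu_shape.2.2 _ _ _ _ hij.1 hi' hi hj' hj, ?_⟩
    rintro ⟨⟩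
    have h1 : (i, j) ∉ lam := fun h1 => hp.2 (h.lam_shape.2.2 _ _ _ _ h1 hi' hi hj' hj)
    obtain ⟨k, hk⟩ := h.alpha _ hij.1 h1
    have h2 := hmin' _ hij.1 _ hk
    have h3 := h.anti _ _ _ _ _ _ hij.1 hi hj hr hk
    have h4 := hij.2
    simp at h2 h4
    omega
  · intro c hc
    refine ⟨h.lam_sub hc, ?_⟩
    rintro rfl
    exact hp.2 hc
  · intro i j i' j' k k' h1
    exact h.anti i j i' j' k k' h1.1
  · rintro ⟨i, j⟩ c' k k' ⟨hc, hcp⟩ hc' hk hk'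
    by_cases h1 : c' = (a, b)
    · subst h1
      rw [hr] at hk'
      cases hk'
      have h2 := hmin' _ hc _ hk
      refine ⟨h2.1, ?_⟩
      rintro rfl
      refine lt_of_le_of_ne (h2.2 rfl) ?_
      rintro (rfl : j = b)
      simp at hcp
      rcases Nat.lt_or_gt_of_ne hcp with h3 | h3
      · exact (h.anti _ _ _ _ _ _ hp.1 h3.le le_rfl hk hr).2 rfl hcp rfl
      · exact (h.anti _ _ _ _ _ _ hc h3.le le_rfl hr hk).2 rfl (Ne.symm hcp) rfl
    · exact h.sep _ _ _ _ hc (hmem _ hc' h1) hk hk'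
  · rintro b' l s rfl hl -
    exact absurd hp.1 (h.notMem_of_le (h.notMem_of_beta hl) m.2.2.1 (h.mem hl).2.2.2 le_rfl
      (by omega))
  · rintro a' d t rfl hd -
    exact absurd hp.1 (h.notMem_of_le (h.notMem_of_beta hd) (h.mem hd).2.2.1 m.2.2.2 (by omega)
      le_rfl)
  · intro c k hc hc' hk
    exact h.sep _ _ _ _ hp.1 (hmem _ hc hc') hr hk

theorem Settled.not_outOfOrder (h : Settled lam mu nu T) {c : Cell} (hc : c ∉ nu) :
    ¬ OutOfOrder T c :=
  GGJdt.not_outOfOrder (h.row _ _ hc) (h.col _ _ hc)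

theorem Settled.exists_sliding_of_alpha (h : Settled lam mu nu T) {c : Cell} {k : ℤ}
    (hc : c ∉ nu) (hk : T c = some (.al k)) : ∃ a b r, Sliding lam mu nu a b r T := by
  have hfin : {c | c ∉ nu ∧ ∃ k, T c = some (.al k)}.Finite :=
    h.mu_shape.1.subset fun c ⟨_, k, hk⟩ => (h.mem hk).1
  obtain ⟨⟨a, b⟩, ⟨hp, r, hr⟩, hmin⟩ := Set.exists_min_image _
    (fun c => toLex (-((T c).elim 0 MEntry.idx : ℤ), c.2)) hfin ⟨c, hc, k, hk⟩
  refine ⟨a, b, r, h.toBase, hp, hr, fun i j hc _ => h.row _ _ hc, fun i j hc _ => h.col _ _ hc,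
    ?_, ?_, ?_⟩
  · rintro b' l s rfl hl hs
    have h1 := h.row _ _ (h.notMem_of_beta hl) _ _ hl hr
    have h2 := h.row _ _ hp _ _ hr hs
    simp at h1 h2
    omega
  · rintro a' d t rfl hd ht
    have h1 := h.col _ _ (h.notMem_of_beta hd) _ _ hd hr
    have h2 := h.col _ _ hp _ _ hr ht
    simp at h1 h2
    omega
  · rintro ⟨i, j⟩ k hc hne hk
    have := hmin (i, j) ⟨hc, k, hk⟩
    simp [hk, hr, MEntry.idx, Prod.Lex.toLex_le_toLex] at this
    refine ⟨by omega, ?_⟩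
    rintro rfl
    refine lt_of_le_of_ne (by simp; omega) ?_
    rintro (rfl : b = j)
    simp at hne
    rcases Nat.lt_or_gt_of_ne hne with h3 | h3
    · exact h.alpha_ne_of_lt hc h3 hk hr
    · exact h.alpha_ne_of_lt hp h3 hr hk

theorem Sliding.settled_insert (h : Sliding lam mu nu a b r T)
    (hleft : ∀ b' l, b = b' + 1 → T (a, b') ≠ some (.be l))
    (hdown : ∀ a' d, a = a' + 1 → T (a', b) ≠ some (.be d)) :
    Settled lam mu (insert (a, b) nu) T := by
  have m := h.mem h.cur
  have hleft' : ∀ b', b = b' + 1 → 1 ≤ b' → (a, b') ∈ nu := by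
    rintro b' rfl hb
    by_contra hn
    obtain ⟨_ | _, he⟩ :=
      h.exists_entry (h.mu_shape.2.2 _ _ _ _ m.1 m.2.2.1 le_rfl hb (by omega)) hn
    · have h1 := h.row _ _ hn (by simp) _ _ he h.cur
      have h2 := h.max _ _ hn (by simp) he
      simp at h1 h2
      omega
    · exact hleft _ _ rfl he
  have hdown' : ∀ a', a = a' + 1 → 1 ≤ a' → (a', b) ∈ nu := by
    rintro a' rfl ha
    by_contra hn
    obtain ⟨_ | _, he⟩ :=
      h.exists_entry (h.mu_shape.2.2 _ _ _ _ m.1 ha (by omega) m.2.2.2 le_rfl) hn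
    · have h1 := h.col _ _ hn (by simp) _ _ he h.cur
      have h2 := h.max _ _ hn (by simp) he
      simp at h1 h2
      omega
    · exact hdown _ _ rfl he
  have hle : ∀ i j, 1 ≤ i → i ≤ a → 1 ≤ j → j ≤ b → (i, j) = (a, b) ∨ (i, j) ∈ nu := by
    intro i j hi hi' hj hj'
    rcases hi'.lt_or_eq with h1 | rfl
    · exact .inr (h.nu_shape.2.2 _ _ _ _ (hdown' (a - 1) (by omega) (by omega)) hi (by omega)
        hj hj')
    · rcases hj'.lt_or_eq with h1 | rfl
      · exact .inr (h.nu_shape.2.2 _ _ _ _ (hleft' (b - 1) (by omega) (by omega)) hi le_rfl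
          hj (by omega))
      · exact .inl rfl
  refine ⟨⟨h.lam_shape, h.mu_shape, ⟨h.nu_shape.1.insert _, ?_, ?_⟩,
    h.lam_sub.trans (Set.subset_insert _ _), Set.insert_subset m.1 h.nu_sub, h.filled, h.pos, ?_,
    ?_, ?_⟩, ?_, ?_⟩
  · rintro c (rfl | hc)
    exacts [m.2.2, h.nu_shape.2.1 _ hc]
  · rintro i j i' j' (h1 | h1) hi' hi hj' hj
    · cases h1
      exact hle _ _ hi' hi hj' hj
    · exact .inr (h.nu_shape.2.2 _ _ _ _ h1 hi' hi hj' hj)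
  · rintro c (rfl | hc) hc'
    exacts [⟨r, h.cur⟩, h.alpha _ hc hc']
  · rintro i j i' j' k k' (h1 | h1) hi hj hk hk'
    · cases h1
      rw [h.cur] at hk'
      cases hk'
      have m' := h.mem hk
      rcases hle i j m'.2.2.1 hi m'.2.2.2 hj with h1 | h1
      · cases h1
        rw [h.cur] at hk
        cases hk
        simp
      · have := h.sep _ _ _ _ h1 h.notMem hk h.cur
        simp at this
        omega
    · exact h.anti _ _ _ _ _ _ h1 hi hj hk hk'
  · rintro c c' k k' (rfl | hc) hc' hk hk'
    · rw [h.cur] at hk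
      cases hk
      exact h.max _ _ (fun h1 => hc' (.inr h1)) (fun h1 => hc' (.inl h1)) hk'
    · exact h.sep _ _ _ _ hc (fun h1 => hc' (.inr h1)) hk hk'
  · exact fun i j hc => h.row _ _ (fun h1 => hc (.inr h1)) (fun h1 => hc (.inl h1))
  · exact fun i j hc => h.col _ _ (fun h1 => hc (.inr h1)) (fun h1 => hc (.inl h1))

end Settled

/-- One step of the algorithm, on triples consisting of the cells whose entries have not been
processed yet, the cell of the moving entry (if any), and the current tableau. -/
inductive Step (lam mu : Set Cell) :
    Set Cell × Option Cell × MixedTableau → Set Cell × Option Cell × MixedTableau → Prop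
  | start {nu : Set Cell} {a b : ℕ} {r : ℤ} {T : MixedTableau}
      (h : Settled lam mu (insert (a, b) nu) T) (h' : Sliding lam mu nu a b r T) :
      Step lam mu (insert (a, b) nu, none, T) (nu, some (a, b), T)
  | slide {nu : Set Cell} {a b a' b' : ℕ} {r : ℤ} {T T' : MixedTableau}
      (h : Sliding lam mu nu a b r T) (h' : Sliding lam mu nu a' b' r T')
      (hmove : (a' = a ∧ b' = b + 1 ∧ ∃ s, MovesRight T a b r s) ∨
        (a' = a + 1 ∧ b' = b ∧ ∃ t, MovesUp T a b r t))
      (hT : T' = swapCells T (a, b) (a', b')) :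
      Step lam mu (nu, some (a, b), T) (nu, some (a', b'), T')
  | finish {nu : Set Cell} {a b : ℕ} {r : ℤ} {T : MixedTableau}
      (h : Sliding lam mu nu a b r T) (ho : ¬ OutOfOrder T (a, b)) :
      Step lam mu (nu, some (a, b), T) (nu, none, T)

section Step

variable {lam mu nu : Set Cell} {T T' E : MixedTableau}
  {x y z : Set Cell × Option Cell × MixedTableau}

theorem not_slide_of_settled_insert {a b a' b' : ℕ} {r : ℤ}
    (hI : Settled lam mu (insert (a', b') nu) T') (h : Sliding lam mu nu a b r T)
    (hmove : (a' = a ∧ b' = b + 1 ∧ ∃ s, MovesRight T a b r s) ∨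
      (a' = a + 1 ∧ b' = b ∧ ∃ t, MovesUp T a b r t)) : False := by
  have m := h.mem h.cur
  have h1 : (a, b) ∈ insert (a', b') nu :=
    hI.nu_shape.2.2 a' b' _ _ (Set.mem_insert _ _) m.2.2.1 (by omega) m.2.2.2 (by omega)
  rcases h1 with h1 | h1
  · simp at h1
    omega
  · exact h.notMem h1

theorem not_movesRight_movesUp {a b : ℕ} {r s t : ℤ} (h : Sliding lam mu nu (a + 1) b r T)
    (h' : Sliding lam mu nu a (b + 1) r T') (hs : MovesRight T (a + 1) b r s)
    (ht : MovesUp T' a (b + 1) r t)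
    (heq : swapCells T (a + 1, b) (a + 1, b + 1) = swapCells T' (a, b + 1) (a + 1, b + 1)) :
    False := by
  have h1 := congrFun heq (a + 1, b)
  have h2 := congrFun heq (a, b + 1)
  rw [swapCells_left, swapCells_of_ne _ (by simp) (by simp), hs.1] at h1
  rw [swapCells_left, swapCells_of_ne _ (by simp) (by simp), ht.1] at h2
  have h3 := h.col _ _ (h.notMem_of_beta h2) (by simp) _ _ h2 hs.1
  have h4 := h'.row _ _ (h'.notMem_of_beta h1.symm) (by simp) _ _ h1.symm ht.1
  simp at h3 h4
  omega

theorem Step.left_unique (h : Step lam mu x z) (h' : Step lam mu y z) : x = y := by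
  cases h with
  | start hI hS =>
    cases h' with
    | start => rfl
    | slide h _ hmove _ => exact (not_slide_of_settled_insert hI h hmove).elim
  | @slide nu a b a' b' r T T' h h1 hmove hT =>
    cases h' with
    | start hI hS => exact (not_slide_of_settled_insert hI h hmove).elim
    | @slide _ a₂ b₂ _ _ r₂ T₂ _ h₂ h1₂ hmove₂ hT₂ =>
      obtain rfl : r = r₂ := by simpa [h1.cur] using h1₂.cur
      have key : (a, b) = (a₂, b₂) → (nu, some (a, b), T) = (nu, some (a₂, b₂), T₂) := by
        rintro ⟨⟩
        rw [← swapCells_swapCells T (a, b) (a', b'), ← hT, hT₂, swapCells_swapCells]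
      rcases hmove with ⟨rfl, rfl, s, hs⟩ | ⟨rfl, rfl, t, ht⟩ <;>
      rcases hmove₂ with ⟨h2, h3, s₂, hs₂⟩ | ⟨h2, h3, t₂, ht₂⟩
      · exact key (by simp; omega)
      · subst h2 h3
        exact (not_movesRight_movesUp h h₂ hs ht₂ (hT.symm.trans hT₂)).elim
      · subst h2 h3
        exact (not_movesRight_movesUp h₂ h hs₂ ht (hT₂.symm.trans hT)).elim
      · exact key (by simp; omega)
  | @finish nu a b r T h ho =>
    cases h' with
    | @finish _ a₂ b₂ r₂ _ h₂ ho₂ =>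
      suffices h1 : (a, b) = (a₂, b₂) by rw [h1]
      by_contra hne
      have h2 := h.max _ _ h₂.notMem (Ne.symm hne) h₂.cur
      have h3 := h₂.max _ _ h.notMem hne h.cur
      simp at h2 h3
      omega

theorem not_step_of_no_alpha (hno : ∀ c ∉ nu, ∀ k, T c ≠ some (.al k)) :
    ¬ Step lam mu x (nu, none, T) := by
  rintro (_ | _ | ⟨h, -⟩)
  exact hno _ h.notMem _ h.cur

/-- The algorithm can be reversed. -/
theorem eq_of_reaches {nu' : Set Cell} (hno : ∀ c ∉ nu, ∀ k, T c ≠ some (.al k))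
    (hno' : ∀ c ∉ nu', ∀ k, T' c ≠ some (.al k))
    (h : Relation.ReflTransGen (Step lam mu) (nu, none, T) x)
    (h' : Relation.ReflTransGen (Step lam mu) (nu', none, T') x) : T = T' := by
  have key : Relation.ReflTransGen (Function.swap (Step lam mu)) (nu, none, T) (nu', none, T') ∨
      Relation.ReflTransGen (Function.swap (Step lam mu)) (nu', none, T') (nu, none, T) :=
    Relation.ReflTransGen.total_of_right_unique (fun _ _ _ h1 h2 => h1.left_unique h2)
      (Relation.reflTransGen_swap.2 h) (Relation.reflTransGen_swap.2 h')
  rcases key with h1 | h1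
  · rcases h1.cases_head with h2 | ⟨y, h2, -⟩
    · simp at h2
      exact h2.2
    · exact (not_step_of_no_alpha hno h2).elim
  · rcases h1.cases_head with h2 | ⟨y, h2, -⟩
    · simp at h2
      exact h2.2.symm
    · exact (not_step_of_no_alpha hno' h2).elim

theorem Step.ggRel_iff (h : Step lam mu x y) : GGRel x.2.2 E ↔ GGRel y.2.2 E := by
  cases h with
  | start => rfl
  | finish => rfl
  | @slide nu a b a' b' r T T' h h1 hmove hT =>
    have hs : GGSlide T (a, b) T' := by
      rw [ggSlide_iff h.cur]
      rcases hmove with ⟨rfl, rfl, hs⟩ | ⟨rfl, rfl, ht⟩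
      · exact .inl (hs.imp fun _ h2 => ⟨h2, hT⟩)
      · exact .inr (ht.imp fun _ h2 => ⟨h2, hT⟩)
    have ho := outOfOrder_of_ggSlide hs
    refine ⟨fun ⟨h2, h3⟩ => ⟨?_, h3⟩, fun ⟨h2, h3⟩ => ⟨.head ((h.ggStep_iff ho).2 hs) h2, h3⟩⟩
    rcases h2.cases_head with rfl | ⟨T'', h4, h5⟩
    · exact absurd ho (h3 _)
    · rwa [ggSlide_unique hs ((h.ggStep_iff ho).1 h4)]

theorem Settled.ggRel_iff (h : Settled lam mu lam T) : GGRel T E ↔ E = T := by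
  have hno : ∀ c, ¬ OutOfOrder T c := by
    intro c hc
    by_cases hn : c ∈ lam
    · rcases hc with ⟨r, s, h1, -⟩ | ⟨r, s, h1, -⟩ <;> exact (h.mem h1).2.1 hn
    · exact h.not_outOfOrder hn hc
  constructor
  · rintro ⟨h1, -⟩
    rcases h1.cases_head with rfl | ⟨T', ⟨c, ⟨r, -, h2, -⟩, -⟩, -⟩
    · rfl
    · exact absurd h2 (hno c)
  · rintro rfl
    exact ⟨.refl, hno⟩

theorem ggRel_iff_of_reaches (h : Relation.ReflTransGen (Step lam mu) (nu, none, T) (lam, none, E))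
    (hE : Settled lam mu lam E) {E' : MixedTableau} : GGRel T E' ↔ E' = E := by
  have key : ∀ {x}, Relation.ReflTransGen (Step lam mu) x (lam, none, E) →
      (GGRel x.2.2 E' ↔ GGRel E E') := by
    intro x hx
    induction hx using Relation.ReflTransGen.head_induction_on with
    | refl => rfl
    | head h1 _ ih => exact h1.ggRel_iff.trans ih
  exact (key h).trans hE.ggRel_iff

end Step

/-- An `α_r` in the cell `(i, j)` would not move to the right. -/
def BlocksRight (nu : Set Cell) (T : MixedTableau) (r : ℤ) (i j : ℕ) : Prop :=
  1 ≤ j → (i + 1, j) ∉ nu → ∀ s, T (i, j + 1) = some (.be s) → r < s + (j + 1) - i →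
    ∃ t, T (i + 1, j) = some (.be t) ∧ s < t ∧ r ≤ t + j - (i + 1)

theorem BlocksRight.congr {nu : Set Cell} {T T' : MixedTableau} {r : ℤ} {i j : ℕ}
    (h : BlocksRight nu T r i j) (h1 : T' (i, j + 1) = T (i, j + 1))
    (h2 : T' (i + 1, j) = T (i + 1, j)) : BlocksRight nu T' r i j := by
  simpa [BlocksRight, h1, h2] using h

/-- The region `R` confines the unprocessed entries `α_r` and lies to the left of the
processed ones. -/
structure RightBarrier (nu : Set Cell) (T : MixedTableau) (r : ℤ) (R : Set Cell) : Prop where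
  up_mem : ∀ i j, (i, j) ∈ R → (i + 1, j) ∈ R
  mem : ∀ c ∈ nu, T c = some (.al r) → c ∈ R
  col_lt : ∀ c ∉ nu, T c = some (.al r) → ∀ y ∈ R, y.2 < c.2
  blocks : ∀ i j, (i, j) ∈ R → (i, j + 1) ∉ R → BlocksRight nu T r i j

/-- While `α_r` at `(a, b)` is moving, it is confined to `R`, and the region `R'` that will
confine the next `α_r` is being traced out by its path. -/
structure RightTrack (nu : Set Cell) (a b : ℕ) (r : ℤ) (T : MixedTableau) (R R' : Set Cell) :
    Prop where
  up_mem : ∀ i j, (i, j) ∈ R → (i + 1, j) ∈ R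
  cur_mem : (a, b) ∈ R
  col_lt : ∀ c ∉ nu, c ≠ (a, b) → T c = some (.al r) → ∀ y ∈ R, y.2 < c.2
  blocks : ∀ i j, a ≤ i → b ≤ j → (i, j) ∈ R → (i, j + 1) ∉ R → BlocksRight nu T r i j
  up_mem' : ∀ i j, (i, j) ∈ R' → (i + 1, j) ∈ R'
  mem' : ∀ c ∈ nu, T c = some (.al r) → c ∈ R'
  lt' : ∀ y ∈ R', y.2 < b
  blocks' : ∀ i j, i < a → (i, j) ∈ R' → (i, j + 1) ∉ R' → BlocksRight nu T r i j
  edge' : ∀ i j, a ≤ i → (i, j) ∈ R' → (i, j + 1) ∉ R' → j + 1 = b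

section Forward

variable {lam mu nu : Set Cell} {T : MixedTableau} {a b : ℕ} {r : ℤ} {R R' : Set Cell}

theorem RightBarrier.track (hR : RightBarrier (insert (a, b) nu) T r R)
    (h : Sliding lam mu nu a b r T) (hI : Settled lam mu (insert (a, b) nu) T) :
    RightTrack nu a b r T R {c | c.2 < b} where
  up_mem := hR.up_mem
  cur_mem := hR.mem _ (Set.mem_insert _ _) h.cur
  col_lt c hc hne := hR.col_lt c (by simp_all)
  blocks i j hi hj h1 h2 h3 h4 := hR.blocks i j h1 h2 h3 (by
    simp only [Set.mem_insert_iff, Prod.mk.injEq, not_or]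
    exact ⟨by omega, h4⟩)
  up_mem' _ _ h1 := h1
  mem' _ hc hk := (h.sep _ _ _ _ hc h.notMem hk h.cur).2 rfl
  lt' _ hy := hy
  blocks' i j hi h1 h2 h3 h4 s hs := by
    obtain rfl : j + 1 = b := by simp at h1 h2; omega
    have m := h.mem hs
    exact absurd (Set.mem_insert _ _) (hI.notMem_of_le (hI.notMem_of_beta hs) m.2.2.1 m.2.2.2
      hi.le le_rfl)
  edge' i j _ h1 h2 := by
    simp at h1 h2
    omega

theorem RightTrack.right_mem (ht : RightTrack nu a b r T R R') (h : Sliding lam mu nu a b r T)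
    {s : ℤ} (hs : MovesRight T a b r s) : (a, b + 1) ∈ R := by
  have m := h.mem h.cur
  by_contra hn
  obtain ⟨t, h1, h2, h3⟩ := ht.blocks a b le_rfl le_rfl ht.cur_mem hn m.2.2.2
    (h.notMem_of_le h.notMem m.2.2.1 m.2.2.2 (by omega) le_rfl) s hs.1 hs.2.1
  have := hs.2.2 t h1 h3
  omega

theorem RightTrack.right (ht : RightTrack nu a b r T R R') (h : Sliding lam mu nu a b r T)
    {s : ℤ} (hs : MovesRight T a b r s) :
    RightTrack nu a (b + 1) r (swapCells T (a, b) (a, b + 1)) R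
      (R' ∪ {c | c.2 = b ∧ a ≤ c.1}) where
  up_mem := ht.up_mem
  cur_mem := ht.right_mem h hs
  col_lt c hc hne hk :=
    have h1 := Sliding.swapped_alpha hs.1 hne hk
    ht.col_lt c hc h1.1 h1.2
  blocks i j hi hj h1 h2 := (ht.blocks i j hi (by omega) h1 h2).congr
    (swapCells_of_ne _ (by simp; omega) (by simp; omega))
    (swapCells_of_ne _ (by simp; omega) (by simp; omega))
  up_mem' i j := by
    rintro (h1 | h1)
    · exact .inl (ht.up_mem' _ _ h1)
    · right
      simp at h1 ⊢
      omega
  mem' c hc hk := by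
    have hne : c ≠ (a, b + 1) := by
      rintro rfl
      exact h.notMem_of_beta hs.1 hc
    exact .inl (ht.mem' c hc (Sliding.swapped_alpha hs.1 hne hk).2)
  lt' y := by
    rintro (h1 | h1)
    · exact (ht.lt' _ h1).trans (by omega)
    · simp at h1
      omega
  blocks' i j hi h1 h2 := by
    have h3 : (i, j) ∈ R' := h1.resolve_right (by simp; omega)
    have h4 := ht.lt' _ h3
    simp at h4
    exact (ht.blocks' i j hi h3 fun h5 => h2 (.inl h5)).congr
      (swapCells_of_ne _ (by simp; omega) (by simp; omega))
      (swapCells_of_ne _ (by simp; omega) (by simp; omega))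
  edge' i j hi h1 h2 := by
    rcases h1 with h1 | h1
    · exact absurd (.inr ⟨ht.edge' i j hi h1 fun h3 => h2 (.inl h3), hi⟩) h2
    · simp at h1
      omega

theorem RightTrack.up (ht : RightTrack nu a b r T R R') (h : Sliding lam mu nu a b r T)
    {t : ℤ} (hs : MovesUp T a b r t) :
    RightTrack nu (a + 1) b r (swapCells T (a, b) (a + 1, b)) R R' where
  up_mem := ht.up_mem
  cur_mem := ht.up_mem _ _ ht.cur_mem
  col_lt c hc hne hk :=
    have h1 := Sliding.swapped_alpha hs.1 hne hk
    ht.col_lt c hc h1.1 h1.2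
  blocks i j hi hj h1 h2 := (ht.blocks i j (by omega) hj h1 h2).congr
    (swapCells_of_ne _ (by simp; omega) (by simp; omega))
    (swapCells_of_ne _ (by simp; omega) (by simp; omega))
  up_mem' := ht.up_mem'
  mem' c hc hk := by
    have hne : c ≠ (a + 1, b) := by
      rintro rfl
      exact h.notMem_of_beta hs.1 hc
    exact ht.mem' c hc (Sliding.swapped_alpha hs.1 hne hk).2
  lt' := ht.lt'
  blocks' i j hi h1 h2 := by
    rcases Nat.lt_succ_iff_lt_or_eq.1 hi with hi | rfl
    · have h4 := ht.lt' _ h1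
      simp at h4
      exact (ht.blocks' i j hi h1 h2).congr
        (swapCells_of_ne _ (by simp; omega) (by simp; omega))
        (swapCells_of_ne _ (by simp; omega) (by simp; omega))
    · obtain rfl := ht.edge' i j le_rfl h1 h2
      intro hj hn s hs' _
      obtain rfl : t = s := by simpa [swapCells_left, hs.1] using hs'
      have hrt := hs.2.1
      have m := h.mem hs.1
      obtain ⟨k | t', he⟩ :=
        h.exists_entry (h.mu_shape.2.2 _ _ _ _ m.1 m.2.2.1 le_rfl hj (by omega)) hn
      · have h3 := h.row _ _ hn (by simp) _ _ he hs.1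
        have h4 := h.max _ _ hn (by simp) he
        simp at h3 h4 hrt
        omega
      · have h3 := h.row _ _ hn (by simp) _ _ he hs.1
        simp at h3 hrt
        refine ⟨t', ?_, by omega, by omega⟩
        rw [swapCells_of_ne _ (by simp) (by simp), he]
  edge' i j hi h1 h2 := ht.edge' i j (by omega) h1 h2

theorem RightTrack.barrier (ht : RightTrack nu a b r T R R') (h : Sliding lam mu nu a b r T)
    (hS : Settled lam mu nu T) : RightBarrier nu T r R' where
  up_mem := ht.up_mem'
  mem := ht.mem'
  col_lt c hc hk y hy := by
    have h1 := ht.lt' y hy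
    by_cases hne : c = (a, b)
    · rwa [hne]
    · exact h1.trans ((h.max c r hc hne hk).2 rfl)
  blocks i j h1 h2 := by
    rcases Nat.lt_or_ge i a with hi | hi
    · exact ht.blocks' i j hi h1 h2
    · obtain rfl := ht.edge' i j hi h1 h2
      obtain ⟨n, rfl⟩ := Nat.exists_eq_add_of_le hi
      intro _ _ s hs hr
      have := hS.col_chain h.notMem h.cur n hs
      simp at this hr
      omega

theorem Sliding.exists_reaches (h : Sliding lam mu nu a b r T) (ht : RightTrack nu a b r T R R')
    (n : ℕ) (hn : ∀ c ∈ mu, c.1 + c.2 < a + b + n) :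
    ∃ T' R'', Relation.ReflTransGen (Step lam mu) (nu, some (a, b), T) (nu, none, T') ∧
      Settled lam mu nu T' ∧ (∃ a' b', Sliding lam mu nu a' b' r T') ∧
      RightBarrier nu T' r R'' := by
  induction n generalizing a b T R' with
  | zero =>
    have := hn _ (h.mem h.cur).1
    simp at this
  | succ n ih =>
    by_cases ho : OutOfOrder T (a, b)
    · rcases movesRight_or_movesUp h.cur ho with ⟨s, hs⟩ | ⟨t, hs⟩
      · have h1 := h.right hs fun c hc hne hk =>
          ht.col_lt c hc hne hk _ (ht.right_mem h hs)
        obtain ⟨T', R'', h2, h3⟩ := ih h1 (ht.right h hs) fun c hc =>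
          (hn c hc).trans_le (by omega)
        exact ⟨T', R'', .head (.slide h h1 (.inl ⟨rfl, rfl, s, hs⟩) rfl) h2, h3⟩
      · have h1 := h.up hs
        obtain ⟨T', R'', h2, h3⟩ := ih h1 (ht.up h hs) fun c hc =>
          (hn c hc).trans_le (by omega)
        exact ⟨T', R'', .head (.slide h h1 (.inr ⟨rfl, rfl, t, hs⟩) rfl) h2, h3⟩
    · have h1 := h.settled ho
      exact ⟨T, R', .single (.finish h ho), h1, ⟨a, b, h⟩, ht.barrier h h1⟩

theorem Sliding.exists_rightBarrier (h : Sliding lam mu nu a b r T) {r' : ℤ} (hr : r' ≠ r) :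
    ∃ R, RightBarrier nu T r' R := by
  rcases hr.lt_or_gt with hr | hr
  · refine ⟨∅, ⟨fun _ _ h1 => h1, fun c hc hk => ?_, fun _ _ _ _ h1 => h1.elim,
      fun _ _ h1 => h1.elim⟩⟩
    have := (h.sep _ _ _ _ hc h.notMem hk h.cur).1
    omega
  · refine ⟨Set.univ, ⟨fun _ _ _ => trivial, fun _ _ _ => trivial, fun c hc hk => ?_,
      fun _ _ _ h1 => absurd trivial h1⟩⟩
    have := h.alpha_le hc hk
    omega

theorem exists_bound (hmu : IsPartitionShape mu) : ∃ n, ∀ c ∈ mu, c.1 + c.2 < n := by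
  obtain ⟨n, hn⟩ := (hmu.1.image fun c => c.1 + c.2).bddAbove
  exact ⟨n + 1, fun c hc => Nat.lt_succ_of_le (hn ⟨c, hc, rfl⟩)⟩

theorem Settled.exists_reaches (h : Settled lam mu nu T)
    (hR : ∀ r, ∃ R, RightBarrier nu T r R) :
    ∃ E, Relation.ReflTransGen (Step lam mu) (nu, none, T) (lam, none, E) ∧
      Settled lam mu lam E := by
  induction hn : nu.ncard generalizing nu T with
  | zero =>
    rw [Set.ncard_eq_zero h.nu_shape.1] at hn
    have : lam = nu := by
      rw [hn]
      exact Set.subset_empty_iff.1 (hn ▸ h.lam_sub)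
    subst this
    exact ⟨T, .refl, h⟩
  | succ n ih =>
    by_cases hne : nu = lam
    · subst hne
      exact ⟨T, .refl, h⟩
    obtain ⟨nu', a, b, r, hp, rfl, hS⟩ := h.exists_sliding_of_ne hne
    rw [Set.ncard_insert_of_notMem hp hS.nu_shape.1] at hn
    obtain ⟨R, hR⟩ := hR r
    obtain ⟨N, hN⟩ := exists_bound hS.mu_shape
    obtain ⟨T', R', h1, h2, ⟨a', b', h3⟩, h4⟩ := hS.exists_reaches (hR.track hS h) N fun c hc =>
      (hN c hc).trans_le (by omega)
    obtain ⟨E, h5, h6⟩ := ih h2 (fun r' => by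
      by_cases hr : r' = r
      · exact ⟨R', hr ▸ h4⟩
      · exact h3.exists_rightBarrier hr) (by omega)
    exact ⟨E, .head (.start h hS) (h1.trans h5), h6⟩

end Forward

/-- An `α_r` in the cell `(i, j + 1)` would not come from the left when a slide is reversed. -/
def BlocksLeft (mu nu : Set Cell) (T : MixedTableau) (r : ℤ) (i j : ℕ) : Prop :=
  (i, j + 1) ∈ mu → ∀ l, T (i, j) = some (.be l) → r ≤ l + j - i →
    ∃ i' e, i = i' + 1 ∧ (i', j + 1) ∉ nu ∧ T (i', j + 1) = some e ∧ ∀ d, e = .be d → d < l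

theorem BlocksLeft.congr {mu nu : Set Cell} {T T' : MixedTableau} {r : ℤ} {i j : ℕ}
    (h : BlocksLeft mu nu T r i j) (h1 : T' (i, j) = T (i, j))
    (h2 : ∀ i', i = i' + 1 → T' (i', j + 1) = T (i', j + 1)) : BlocksLeft mu nu T' r i j := by
  intro hm l hl hr
  obtain ⟨i', e, hi, hn, he, hd⟩ := h hm l (h1 ▸ hl) hr
  exact ⟨i', e, hi, hn, by rw [h2 _ hi, he], hd⟩

/-- The region `R` confines the entries `α_r` which have not been moved back yet and lies to the
right of the other ones. -/
structure LeftBarrier (mu nu : Set Cell) (T : MixedTableau) (r : ℤ) (R : Set Cell) : Prop where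
  down_mem : ∀ i j, (i + 1, j) ∈ R → (i, j) ∈ R
  mem : ∀ c ∉ nu, T c = some (.al r) → c ∈ R
  lt_col : ∀ c ∈ nu, T c = some (.al r) → ∀ y ∈ R, c.2 < y.2
  blocks : ∀ i j, (i, j + 1) ∈ R → (i, j) ∉ R → BlocksLeft mu nu T r i j

/-- While `α_r` at `(a, b)` is moving back, it is confined to `R`, and the region `R'` that will
confine the next `α_r` is being traced out by its path. -/
structure LeftTrack (mu nu : Set Cell) (a b : ℕ) (r : ℤ) (T : MixedTableau) (R R' : Set Cell) :
    Prop where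
  down_mem : ∀ i j, (i + 1, j) ∈ R → (i, j) ∈ R
  cur_mem : (a, b) ∈ R
  lt_col : ∀ c ∈ nu, T c = some (.al r) → ∀ y ∈ R, c.2 < y.2
  blocks : ∀ i j, i ≤ a → j + 1 ≤ b → (i, j + 1) ∈ R → (i, j) ∉ R → BlocksLeft mu nu T r i j
  down_mem' : ∀ i j, (i + 1, j) ∈ R' → (i, j) ∈ R'
  mem' : ∀ c ∉ nu, c ≠ (a, b) → T c = some (.al r) → c ∈ R'
  lt' : ∀ y ∈ R', b < y.2
  blocks' : ∀ i j, a < i → (i, j + 1) ∈ R' → (i, j) ∉ R' → BlocksLeft mu nu T r i j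
  edge' : ∀ i j, i ≤ a → (i, j + 1) ∈ R' → (i, j) ∉ R' → j = b

section Backward

variable {lam mu nu : Set Cell} {T : MixedTableau} {a b : ℕ} {r : ℤ} {R R' : Set Cell}

theorem LeftBarrier.track (hR : LeftBarrier mu nu T r R) (h : Sliding lam mu nu a b r T)
    (hS : Settled lam mu nu T) : LeftTrack mu nu a b r T R {c | b < c.2} where
  down_mem := hR.down_mem
  cur_mem := hR.mem _ h.notMem h.cur
  lt_col := hR.lt_col
  blocks i j _ _ := hR.blocks i j
  down_mem' _ _ h1 := h1
  mem' c hc hne hk := (h.max c r hc hne hk).2 rfl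
  lt' _ hy := hy
  blocks' i j hi h1 h2 _ l hl hr := by
    obtain rfl : j = b := by simp at h1 h2; omega
    obtain ⟨n, rfl⟩ := Nat.exists_eq_add_of_lt hi
    have := hS.col_chain h.notMem h.cur (n + 1) hl
    simp at this hr
    omega
  edge' i j _ h1 h2 := by
    simp at h1 h2
    omega

theorem LeftTrack.left_mem (ht : LeftTrack mu nu a (b + 1) r T R R')
    (h : Sliding lam mu nu a (b + 1) r T) {l : ℤ} (hl : ReversesLeft T a b l) : (a, b) ∈ R := by
  have hrl := h.row _ _ (h.notMem_of_beta hl.1) (by simp) _ _ hl.1 h.cur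
  by_contra hn
  obtain ⟨a', e, rfl, hn', he, hd⟩ := ht.blocks a b le_rfl le_rfl ht.cur_mem hn
    (h.mem h.cur).1 l hl.1 (by simpa using hrl)
  rcases e with k | d
  · have h1 := h.col _ _ hn' (by simp) _ _ he h.cur
    have h2 := h.alpha_le hn' he
    simp at h1
    omega
  · have h1 := hd d rfl
    have h2 := hl.2 _ _ rfl he
    omega

theorem LeftTrack.left (ht : LeftTrack mu nu a (b + 1) r T R R')
    (h : Sliding lam mu nu a (b + 1) r T) {l : ℤ} (hl : ReversesLeft T a b l) :
    LeftTrack mu nu a b r (swapCells T (a, b + 1) (a, b)) R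
      (R' ∪ {c | c.2 = b + 1 ∧ c.1 ≤ a}) where
  down_mem := ht.down_mem
  cur_mem := ht.left_mem h hl
  lt_col c hc hk := by
    have hne : c ≠ (a, b) := by
      rintro rfl
      exact h.notMem_of_beta hl.1 hc
    exact ht.lt_col c hc (Sliding.swapped_alpha hl.1 hne hk).2
  blocks i j hi hj h1 h2 := (ht.blocks i j hi (by omega) h1 h2).congr
    (swapCells_of_ne _ (by simp; omega) (by simp; omega))
    (fun _ _ => swapCells_of_ne _ (by simp; omega) (by simp; omega))
  down_mem' i j := by
    rintro (h1 | h1)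
    · exact .inl (ht.down_mem' _ _ h1)
    · right
      simp at h1 ⊢
      omega
  mem' c hc hne hk :=
    have h1 := Sliding.swapped_alpha hl.1 hne hk
    .inl (ht.mem' c hc h1.1 h1.2)
  lt' y := by
    rintro (h1 | h1)
    · exact lt_trans (by omega) (ht.lt' _ h1)
    · simp at h1
      omega
  blocks' i j hi h1 h2 := by
    have h3 : (i, j + 1) ∈ R' := h1.resolve_right (by simp; omega)
    have h4 := ht.lt' _ h3
    simp at h4
    exact (ht.blocks' i j hi h3 fun h5 => h2 (.inl h5)).congr
      (swapCells_of_ne _ (by simp; omega) (by simp; omega))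
      (fun _ _ => swapCells_of_ne _ (by simp; omega) (by simp; omega))
  edge' i j hi h1 h2 := by
    rcases h1 with h1 | h1
    · exact absurd (.inr ⟨ht.edge' i j hi h1 fun h3 => h2 (.inl h3), hi⟩) h2
    · simp at h1
      omega

theorem LeftTrack.down (ht : LeftTrack mu nu (a + 1) b r T R R')
    (h : Sliding lam mu nu (a + 1) b r T) {d : ℤ} (hd : ReversesDown T a b d) :
    LeftTrack mu nu a b r (swapCells T (a + 1, b) (a, b)) R R' where
  down_mem := ht.down_mem
  cur_mem := ht.down_mem _ _ ht.cur_mem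
  lt_col c hc hk := by
    have hne : c ≠ (a, b) := by
      rintro rfl
      exact h.notMem_of_beta hd.1 hc
    exact ht.lt_col c hc (Sliding.swapped_alpha hd.1 hne hk).2
  blocks i j hi hj h1 h2 := (ht.blocks i j (by omega) hj h1 h2).congr
    (swapCells_of_ne _ (by simp; omega) (by simp; omega))
    (fun _ _ => swapCells_of_ne _ (by simp; omega) (by simp; omega))
  down_mem' := ht.down_mem'
  mem' c hc hne hk :=
    have h1 := Sliding.swapped_alpha hd.1 hne hk
    ht.mem' c hc h1.1 h1.2
  lt' := ht.lt'
  blocks' i j hi h1 h2 := by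
    rcases (Nat.succ_le_of_lt hi).lt_or_eq with hi | rfl
    · have h4 := ht.lt' _ h1
      simp at h4
      exact (ht.blocks' i j hi h1 h2).congr
        (swapCells_of_ne _ (by simp; omega) (by simp; omega))
        (fun _ _ => swapCells_of_ne _ (by simp; omega) (by simp; omega))
    · obtain rfl := ht.edge' _ j le_rfl h1 h2
      intro hm l hl _
      obtain rfl : d = l := by simpa [swapCells_left, hd.1] using hl
      have hn := h.notMem_of_beta hd.1
      have m := h.mem hd.1
      have hn' := h.notMem_of_le hn m.2.2.1 m.2.2.2 le_rfl (Nat.le_succ j)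
      obtain ⟨e, he⟩ :=
        h.exists_entry (h.mu_shape.2.2 _ _ _ _ hm m.2.2.1 (Nat.le_succ a) (by omega) le_rfl) hn'
      refine ⟨a, e, rfl, hn', by rw [swapCells_of_ne _ (by simp) (by simp), he], ?_⟩
      rintro d' rfl
      have h3 := h.row _ _ hn (by simp) _ _ hd.1 he
      simp at h3
      omega
  edge' i j hi h1 h2 := ht.edge' i j (by omega) h1 h2

theorem LeftTrack.barrier (ht : LeftTrack mu nu a b r T R R') (h : Sliding lam mu nu a b r T)
    (hI : Settled lam mu (insert (a, b) nu) T) : LeftBarrier mu (insert (a, b) nu) T r R' where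
  down_mem := ht.down_mem'
  mem c hc hk := ht.mem' c (fun h1 => hc (.inr h1)) (fun h1 => hc (.inl h1)) hk
  lt_col c hc hk y hy := by
    have h1 := ht.lt' y hy
    rcases hc with rfl | hc
    · exact h1
    · exact ((h.sep _ _ _ _ hc h.notMem hk h.cur).2 rfl).trans h1
  blocks i j h1 h2 := by
    rcases Nat.lt_or_ge a i with hi | hi
    · intro hm l hl hr
      obtain ⟨i', e, h3, h4, h5⟩ := ht.blocks' i j hi h1 h2 hm l hl hr
      refine ⟨i', e, h3, ?_, h5⟩
      have h6 := ht.lt' _ h1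
      simp at h6
      simp only [Set.mem_insert_iff, Prod.mk.injEq, not_or]
      exact ⟨by omega, h4⟩
    · obtain rfl := ht.edge' i j hi h1 h2
      intro _ l hl _
      have m := h.mem hl
      exact absurd (hI.nu_shape.2.2 a j _ _ (Set.mem_insert _ _) m.2.2.1 hi m.2.2.2 le_rfl)
        (hI.notMem_of_beta hl)

theorem reversesLeft_or_reversesDown
    (h : (∃ b' l, b = b' + 1 ∧ T (a, b') = some (.be l)) ∨
      ∃ a' d, a = a' + 1 ∧ T (a', b) = some (.be d)) :
    (∃ b' l, b = b' + 1 ∧ ReversesLeft T a b' l) ∨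
      ∃ a' d, a = a' + 1 ∧ ReversesDown T a' b d := by
  by_cases hl : ∃ b' l, b = b' + 1 ∧ ReversesLeft T a b' l
  · exact .inl hl
  right
  by_cases hd : ∃ a' d, a = a' + 1 ∧ T (a', b) = some (.be d)
  · obtain ⟨a', d, rfl, hd⟩ := hd
    refine ⟨a', d, rfl, hd, ?_⟩
    rintro b' l rfl hl'
    by_contra hlt
    refine hl ⟨b', l, rfl, hl', ?_⟩
    intro a'' d' h1 h2
    obtain rfl : a' = a'' := by omega
    rw [hd] at h2
    cases h2
    omega
  · obtain ⟨b', l, rfl, h1⟩ := h.resolve_right hd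
    exact absurd ⟨b', l, rfl, h1, fun a' d h2 h3 => absurd ⟨a', d, h2, h3⟩ hd⟩ hl

theorem Sliding.exists_reached (h : Sliding lam mu nu a b r T)
    (ht : LeftTrack mu nu a b r T R R') (n : ℕ) (hn : a + b ≤ n) :
    ∃ a' b' T' R'', Relation.ReflTransGen (Step lam mu) (nu, some (a', b'), T')
        (nu, some (a, b), T) ∧
      Sliding lam mu nu a' b' r T' ∧ Settled lam mu (insert (a', b') nu) T' ∧
      LeftBarrier mu (insert (a', b') nu) T' r R'' := by
  induction n generalizing a b T R' with
  | zero =>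
    have := h.mem h.cur
    omega
  | succ n ih =>
    by_cases hex : (∃ b' l, b = b' + 1 ∧ T (a, b') = some (.be l)) ∨
      ∃ a' d, a = a' + 1 ∧ T (a', b) = some (.be d)
    · rcases reversesLeft_or_reversesDown hex with ⟨b', l, rfl, hl⟩ | ⟨a', d, rfl, hd⟩
      · have h1 := h.left hl fun c hc hk => ht.lt_col c hc hk _ (ht.left_mem h hl)
        obtain ⟨a', b', T', R'', h2, h3⟩ := ih h1 (ht.left h hl) (by omega)
        refine ⟨a', b', T', R'', h2.tail (.slide h1 h (.inl ⟨rfl, rfl, l, hl.movesRight h⟩) ?_), h3⟩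
        rw [swapCells_comm T, swapCells_swapCells]
      · have h1 := h.down hd
        obtain ⟨a', b', T', R'', h2, h3⟩ := ih h1 (ht.down h hd) (by omega)
        refine ⟨a', b', T', R'', h2.tail (.slide h1 h (.inr ⟨rfl, rfl, d, hd.movesUp h⟩) ?_), h3⟩
        rw [swapCells_comm T, swapCells_swapCells]
    · have hI := h.settled_insert (fun b' l h1 h2 => hex (.inl ⟨b', l, h1, h2⟩))
        (fun a' d h1 h2 => hex (.inr ⟨a', d, h1, h2⟩))
      exact ⟨a, b, T, R', .refl, h, hI, ht.barrier h hI⟩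

theorem Sliding.exists_leftBarrier (h : Sliding lam mu nu a b r T) {r' : ℤ} (hr : r' ≠ r) :
    ∃ R, LeftBarrier mu (insert (a, b) nu) T r' R := by
  rcases hr.lt_or_gt with hr | hr
  · refine ⟨Set.univ, ⟨fun _ _ _ => trivial, fun _ _ _ => trivial, ?_,
      fun _ _ _ h1 => absurd trivial h1⟩⟩
    rintro c (rfl | hc) hk
    · have := h.cur
      simp_all
    · have := (h.sep _ _ _ _ hc h.notMem hk h.cur).1
      omega
  · refine ⟨∅, ⟨fun _ _ h1 => h1, fun c hc hk => ?_, fun _ _ _ _ h1 => h1.elim,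
      fun _ _ h1 => h1.elim⟩⟩
    have := h.alpha_le (fun h1 => hc (.inr h1)) hk
    omega

theorem Settled.exists_reached (h : Settled lam mu nu T)
    (hR : ∀ r, ∃ R, LeftBarrier mu nu T r R) :
    ∃ nu' T', Relation.ReflTransGen (Step lam mu) (nu', none, T') (nu, none, T) ∧
      Settled lam mu nu' T' ∧ ∀ c ∉ nu', ∀ k, T' c ≠ some (.al k) := by
  induction hn : (mu \ nu).ncard using Nat.strong_induction_on generalizing nu T with
  | _ n ih =>
    by_cases hno : ∀ c ∉ nu, ∀ k, T c ≠ some (.al k)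
    · exact ⟨nu, T, .refl, h, hno⟩
    push Not at hno
    obtain ⟨c, hc, k, hk⟩ := hno
    obtain ⟨a, b, r, hS⟩ := h.exists_sliding_of_alpha hc hk
    obtain ⟨R, hR⟩ := hR r
    obtain ⟨a', b', T', R', h1, h2, h3, h4⟩ := hS.exists_reached (hR.track hS h) _ le_rfl
    have hlt : (mu \ insert (a', b') nu).ncard < n := by
      rw [← hn]
      refine Set.ncard_lt_ncard (Set.ssubset_iff_exists.2 ⟨?_, (a', b'), ?_, by simp⟩)
        h.mu_shape.1.sdiff
      · exact Set.sdiff_subset_sdiff_right (Set.subset_insert _ _)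
      · exact ⟨(h2.mem h2.cur).1, h2.notMem⟩
    obtain ⟨nu', T'', h5, h6⟩ := ih _ hlt h3 (fun r' => by
      by_cases hr : r' = r
      · exact ⟨R', hr ▸ h4⟩
      · exact h2.exists_leftBarrier hr) rfl
    exact ⟨nu', T'', ((h5.tail (.start h3 h2)).trans h1).tail
      (.finish hS (h.not_outOfOrder hS.notMem)), h6⟩

end Backward

theorem exists_settled_of_sorted {lam mu : Set Cell} {T : MixedTableau} (hT : IsMixedTableau T)
    (hs : HasSkewShape T lam mu) (ha : AlphaColumnStrict T) (hb : BetaRowStrict T)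
    (hab : ABSortedShape T lam mu) :
    ∃ nu, Settled lam mu nu T ∧ ∀ c ∉ nu, ∀ k, T c ≠ some (.al k) := by
  obtain ⟨nu, hnu, h1, h2, hal, hbe⟩ := hab
  have mem_nu : ∀ c k, T c = some (.al k) → c ∈ nu := fun c k hk =>
    (hal.subset ⟨k, hk⟩ : c ∈ nu \ lam).1
  have mem_mu : ∀ c e, T c = some e → c ∈ mu := fun c e he =>
    (hs.2.2.2.subset (by simp [mshape, he]) : c ∈ mu \ lam).1
  have beta : ∀ c e, T c = some e → c ∉ nu → ∃ s, e = .be s := by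
    rintro c (k | s) he hc
    · exact absurd (mem_nu c k he) hc
    · exact ⟨s, rfl⟩
  have up : ∀ i j i' j' e, T (i, j) = some e → (i, j) ∉ nu → i ≤ i' → j ≤ j' → (i', j') ∉ nu := by
    intro i j i' j' e he hn hi hj hn'
    have m := hs.2.1.2.1 _ (mem_mu _ _ he)
    exact hn (hnu.2.2 _ _ _ _ hn' m.1 hi m.2 hj)
  refine ⟨nu, ⟨⟨hs.1, hs.2.1, hnu, h1, h2, hs.2.2.2, hT.2.2, ?_, ?_, ?_⟩, ?_, ?_⟩,
    fun c hc k hk => hc (mem_nu c k hk)⟩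
  · exact fun c hc hc' => hal.superset ⟨hc, hc'⟩
  · intro i j i' j' k k' _ hi hj hk hk'
    exact ⟨ha.1 _ _ _ _ hk hk' trivial trivial hi hj,
      fun hj' hne => ha.2 _ _ _ _ hk hk' trivial trivial hj' (by simp [hne])⟩
  · exact fun c c' k k' _ hc' _ hk' => absurd (mem_nu c' k' hk') hc'
  · intro i j hn e e' he he'
    obtain ⟨s, rfl⟩ := beta _ _ he hn
    obtain ⟨t, rfl⟩ := beta _ _ he' (up _ _ _ _ _ he hn le_rfl (Nat.le_succ j))
    have h3 := hb.1 _ _ _ _ he he' trivial trivial le_rfl (Nat.le_succ j)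
    have h4 := hb.2 _ _ _ _ he he' trivial trivial rfl (by simp)
    simp [MEntry.idx] at h3 h4 ⊢
    omega
  · intro i j hn e e' he he'
    obtain ⟨s, rfl⟩ := beta _ _ he hn
    obtain ⟨t, rfl⟩ := beta _ _ he' (up _ _ _ _ _ he hn (Nat.le_succ i) le_rfl)
    have h3 := hb.1 _ _ _ _ he he' trivial trivial (Nat.le_succ i) le_rfl
    simp [MEntry.idx] at h3 ⊢
    omega

namespace Base

variable {lam mu nu : Set Cell} {T : MixedTableau}

theorem isMixedTableau (h : Base lam mu nu T) : IsMixedTableau T := by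
  refine ⟨?_, ?_, h.pos⟩
  · rw [h.filled]
    exact h.mu_shape.1.subset Set.sdiff_subset
  · rw [h.filled]
    exact fun c hc => h.mu_shape.2.1 c hc.1

theorem hasSkewShape (h : Base lam mu nu T) : HasSkewShape T lam mu :=
  ⟨h.lam_shape, h.mu_shape, h.lam_sub.trans h.nu_sub, h.filled⟩

theorem alphaColumnStrict (h : Base lam mu nu T) (hno : ∀ c ∉ nu, ∀ k, T c ≠ some (.al k)) :
    AlphaColumnStrict T := by
  have mem_nu : ∀ c k, T c = some (.al k) → c ∈ nu := fun c k hk =>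
    by_contra fun hc => hno c hc k hk
  constructor
  · rintro ⟨i, j⟩ ⟨i', j'⟩ (k | k) (k' | k') he he' hp hp' hi hj
    · exact (h.anti _ _ _ _ _ _ (mem_nu _ _ he') hi hj he he').1
    all_goals cases hp <;> cases hp'
  · rintro ⟨i, j⟩ ⟨i', j'⟩ (k | k) (k' | k') he he' hp hp' hj hne
    · obtain rfl : j = j' := hj
      have hne' : i ≠ i' := fun h1 => hne (by rw [h1])
      rcases le_total i i' with hi | hi
      · exact (h.anti _ _ _ _ _ _ (mem_nu _ _ he') hi le_rfl he he').2 rfl hne'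
      · exact ((h.anti _ _ _ _ _ _ (mem_nu _ _ he) hi le_rfl he' he).2 rfl hne'.symm).symm
    all_goals cases hp <;> cases hp'

theorem abSortedShape (h : Base lam mu nu T) (hno : ∀ c ∉ nu, ∀ k, T c ≠ some (.al k)) :
    ABSortedShape T lam mu := by
  refine ⟨nu, h.nu_shape, h.lam_sub, h.nu_sub, ?_, ?_⟩
  · ext ⟨i, j⟩
    constructor
    · rintro ⟨k, hk⟩
      exact ⟨by_contra fun hc => hno _ hc k hk, (h.mem hk).2.1⟩
    · exact fun hc => h.alpha _ hc.1 hc.2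
  · ext ⟨i, j⟩
    constructor
    · rintro ⟨k, hk⟩
      exact ⟨(h.mem hk).1, h.notMem_of_beta hk⟩
    · intro hc
      obtain ⟨k | k, hk⟩ := h.exists_entry hc.1 hc.2
      exacts [absurd hk (hno _ hc.2 k), ⟨k, hk⟩]

end Base

namespace Settled

variable {lam mu nu : Set Cell} {T : MixedTableau}

theorem betaRowStrict (h : Settled lam mu nu T) (hno : ∀ c ∉ nu, ∀ k, T c ≠ some (.al k)) :
    BetaRowStrict T := by
  have row : ∀ i j n s t, T (i, j) = some (.be s) → T (i, j + n) = some (.be t) →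
      t + n ≤ s := by
    intro i j n s t he he'
    have := h.row_chain (h.notMem_of_beta he) he n he'
    simp at this
    omega
  have col : ∀ i j n s t, T (i, j) = some (.be s) → T (i + n, j) = some (.be t) → t ≤ s := by
    intro i j n s t he he'
    have := h.col_chain (h.notMem_of_beta he) he n he'
    simp at this
    omega
  constructor
  · rintro ⟨i, j⟩ ⟨i', j'⟩ (k | s) (k' | t) he he' hp hp' hi hj
    case be.be =>
      obtain ⟨m, rfl⟩ := Nat.exists_eq_add_of_le hi
      obtain ⟨n, rfl⟩ := Nat.exists_eq_add_of_le hj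
      obtain ⟨h1, k | u, h2⟩ := h.exists_corner (h.notMem_of_beta he) he he' (le_refl i)
        (Nat.le_add_right j n) (Nat.le_add_right i m) (le_refl (j + n))
      · exact absurd h2 (hno _ h1 k)
      · have h3 := row _ _ _ _ _ he h2
        have h4 := col _ _ _ _ _ h2 he'
        simp only [MEntry.idx]
        omega
    all_goals cases hp <;> cases hp'
  · rintro ⟨i, j⟩ ⟨i', j'⟩ (k | s) (k' | t) he he' hp hp' hi hne
    case be.be =>
      obtain rfl : i = i' := hi
      have hne' : j ≠ j' := fun h1 => hne (by rw [h1])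
      simp only [MEntry.idx]
      rcases le_total j j' with hj | hj
      all_goals
        obtain ⟨n, rfl⟩ := Nat.exists_eq_add_of_le hj
        first
        | have := row _ _ _ _ _ he he'
          omega
        | have := row _ _ _ _ _ he' he
          omega
    all_goals cases hp <;> cases hp'

theorem totallyColumnStrict (h : Settled lam mu lam T) :
    TotallyColumnStrict (cBetaPlus T) :=
  totallyColumnStrict_cBetaPlus_iff.2 fun i j =>
    ⟨fun e e' he => h.row i j (h.mem he).2.1 e e' he,
      fun e e' he => h.col i j (h.mem he).2.1 e e' he⟩

theorem of_totallyColumnStrict (hT : IsMixedTableau T) (hs : HasSkewShape T lam mu)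
    (h : TotallyColumnStrict (cBetaPlus T)) : Settled lam mu lam T := by
  have hlam : ∀ c e, T c = some e → c ∉ lam := fun c e he =>
    (hs.2.2.2.subset (by simp [mshape, he]) : c ∈ mu \ lam).2
  rw [totallyColumnStrict_cBetaPlus_iff] at h
  exact
    { lam_shape := hs.1
      mu_shape := hs.2.1
      nu_shape := hs.1
      lam_sub := subset_rfl
      nu_sub := hs.2.2.1
      filled := hs.2.2.2
      pos := hT.2.2
      alpha := fun c hc hc' => absurd hc hc'
      anti := fun _ _ _ _ _ _ hc _ _ _ hk' => absurd hc (hlam _ _ hk')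
      sep := fun _ _ _ _ hc _ hk => absurd hc (hlam _ _ hk)
      row := fun i j _ => (h i j).1
      col := fun i j _ => (h i j).2 }

theorem exists_reaches_of_sorted (h : Settled lam mu nu T)
    (hno : ∀ c ∉ nu, ∀ k, T c ≠ some (.al k)) :
    ∃ E, Relation.ReflTransGen (Step lam mu) (nu, none, T) (lam, none, E) ∧
      Settled lam mu lam E :=
  h.exists_reaches fun r => ⟨Set.univ,
    { up_mem := fun _ _ _ => trivial
      mem := fun _ _ _ => trivial
      col_lt := fun c hc hk => absurd hk (hno c hc r)
      blocks := fun _ _ _ h1 => absurd trivial h1 }⟩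

theorem exists_reached_of_ordered (h : Settled lam mu lam T) :
    ∃ nu' T', Relation.ReflTransGen (Step lam mu) (nu', none, T') (lam, none, T) ∧
      Settled lam mu nu' T' ∧ ∀ c ∉ nu', ∀ k, T' c ≠ some (.al k) :=
  h.exists_reached fun _ => ⟨Set.univ,
    { down_mem := fun _ _ _ => trivial
      mem := fun _ _ _ => trivial
      lt_col := fun _ hc hk => absurd hc (h.mem hk).2.1
      blocks := fun _ _ _ h1 => absurd trivial h1 }⟩

end Settled

end GGJdt

/-- Proposition 4.12(1): the GG-jdt map is a bijection from the set of
`α`-column-strict, `β`-row-strict, `(α,β)`-sorted mixed tableaux of shape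
`mu / lam` onto the set of mixed tableaux `E` of shape `mu / lam` such that
`c_β^+(E)` is totally column-strict. -/
theorem ggjdt_bijection (lam mu : Set Cell)
    (hl : IsPartitionShape lam) (hm : IsPartitionShape mu) (hsub : lam ⊆ mu) :
    (∀ T : MixedTableau, IsMixedTableau T → HasSkewShape T lam mu →
      AlphaColumnStrict T → BetaRowStrict T → ABSortedShape T lam mu →
      (∃ E, GGRel T E) ∧ (∀ E E', GGRel T E → GGRel T E' → E = E') ∧
      (∀ E, GGRel T E → IsMixedTableau E ∧ HasSkewShape E lam mu ∧
        TotallyColumnStrict (cBetaPlus E))) ∧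
    (∀ T T' E : MixedTableau,
      (IsMixedTableau T ∧ HasSkewShape T lam mu ∧ AlphaColumnStrict T ∧
        BetaRowStrict T ∧ ABSortedShape T lam mu) →
      (IsMixedTableau T' ∧ HasSkewShape T' lam mu ∧ AlphaColumnStrict T' ∧
        BetaRowStrict T' ∧ ABSortedShape T' lam mu) →
      GGRel T E → GGRel T' E → T = T') ∧
    (∀ E : MixedTableau, IsMixedTableau E → HasSkewShape E lam mu →
      TotallyColumnStrict (cBetaPlus E) →
      ∃ T, IsMixedTableau T ∧ HasSkewShape T lam mu ∧ AlphaColumnStrict T ∧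
        BetaRowStrict T ∧ ABSortedShape T lam mu ∧ GGRel T E) := by
  refine ⟨fun T hT hs ha hb hab => ?_, ?_, fun E hT hs hE => ?_⟩
  · obtain ⟨nu, hS, hno⟩ := GGJdt.exists_settled_of_sorted hT hs ha hb hab
    obtain ⟨E, hr, hE⟩ := hS.exists_reaches_of_sorted hno
    have key : ∀ E', GGRel T E' ↔ E' = E := fun E' => GGJdt.ggRel_iff_of_reaches hr hE
    refine ⟨⟨E, (key E).2 rfl⟩, fun E₁ E₂ h1 h2 => ?_, fun E' h1 => ?_⟩
    · rw [(key _).1 h1, (key _).1 h2]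
    · rw [(key _).1 h1]
      exact ⟨hE.isMixedTableau, hE.hasSkewShape, hE.totallyColumnStrict⟩
  · rintro T T' E ⟨hT, hs, ha, hb, hab⟩ ⟨hT', hs', ha', hb', hab'⟩ h h'
    obtain ⟨nu, hS, hno⟩ := GGJdt.exists_settled_of_sorted hT hs ha hb hab
    obtain ⟨nu', hS', hno'⟩ := GGJdt.exists_settled_of_sorted hT' hs' ha' hb' hab'
    obtain ⟨E₁, hr, hE⟩ := hS.exists_reaches_of_sorted hno
    obtain ⟨E₂, hr', hE'⟩ := hS'.exists_reaches_of_sorted hno'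
    obtain rfl := (GGJdt.ggRel_iff_of_reaches hr hE).1 h
    obtain rfl := (GGJdt.ggRel_iff_of_reaches hr' hE').1 h'
    exact GGJdt.eq_of_reaches hno hno' hr hr'
  · obtain ⟨nu, T, hr, hS, hno⟩ :=
      (GGJdt.Settled.of_totallyColumnStrict hT hs hE).exists_reached_of_ordered
    exact ⟨T, hS.isMixedTableau, hS.hasSkewShape, hS.alphaColumnStrict hno, hS.betaRowStrict hno,
      hS.abSortedShape hno,
      (GGJdt.ggRel_iff_of_reaches hr (.of_totallyColumnStrict hT hs hE)).2 rfl⟩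
end

section
/- Let T be an α-column-strict, β-row-strict, (α,β)-sorted mixed tableau. Then each iteration of the GG-jdt slide performed during the computation of jdt_GG(T) results in a tableau that is again α-column-strict and β-row-strict. -/
/-!
Common definitions: mixed tableaux, tableau switching, shuffling, GG-jdt,
hook-valued tableaux and the uncrowding algorithms.
Conventions: French notation, cells `(i, j)` with `i` the row index (counted
from the bottom) and `j` the column index, both `≥ 1`.
-/

open scoped Classical

theorem alphaColumnStrict_iff {U : MixedTableau} :
    AlphaColumnStrict U ↔
      (∀ c c' p q, U c = some (.al p) → U c' = some (.al q) → c ≤ c' → q ≤ p) ∧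
      (∀ c c' p, U c = some (.al p) → U c' = some (.al p) → c.2 = c'.2 → c = c') := by
  constructor
  · rintro ⟨h, h'⟩
    refine ⟨fun c c' p q hc hc' hle => h c c' _ _ hc hc' trivial trivial hle.1 hle.2,
      fun c c' p hc hc' he => ?_⟩
    by_contra hne
    exact h' c c' _ _ hc hc' trivial trivial he hne rfl
  · rintro ⟨h, h'⟩
    refine ⟨?_, ?_⟩
    · rintro c c' (p | p) (q | q) hc hc' he he' h₁ h₂
      · exact h c c' p q hc hc' ⟨h₁, h₂⟩
      all_goals first | exact he.elim | exact he'.elim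
    · rintro c c' (p | p) (q | q) hc hc' he he' h₁ hne heq
      · change p = q at heq
        subst heq
        exact hne (h' c c' p hc hc' h₁)
      all_goals first | exact he.elim | exact he'.elim

theorem betaRowStrict_iff {U : MixedTableau} :
    BetaRowStrict U ↔
      (∀ c c' p q, U c = some (.be p) → U c' = some (.be q) → c ≤ c' → q ≤ p) ∧
      (∀ c c' p, U c = some (.be p) → U c' = some (.be p) → c.1 = c'.1 → c = c') := by
  constructor
  · rintro ⟨h, h'⟩
    refine ⟨fun c c' p q hc hc' hle => h c c' _ _ hc hc' trivial trivial hle.1 hle.2,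
      fun c c' p hc hc' he => ?_⟩
    by_contra hne
    exact h' c c' _ _ hc hc' trivial trivial he hne rfl
  · rintro ⟨h, h'⟩
    refine ⟨?_, ?_⟩
    · rintro c c' (p | p) (q | q) hc hc' he he' h₁ h₂
      on_goal 4 => exact h c c' p q hc hc' ⟨h₁, h₂⟩
      all_goals first | exact he.elim | exact he'.elim
    · rintro c c' (p | p) (q | q) hc hc' he he' h₁ hne heq
      on_goal 4 =>
        change p = q at heq
        subst heq
        exact hne (h' c c' p hc hc' h₁)
      all_goals first | exact he.elim | exact he'.elim

/-- Witness that the second of two equal `α` entries crossed above the first: its path left every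
row between them through a cell whose `β` entry is smaller than the `β` entry to the northwest. -/
def CrossingWitness (U : MixedTableau) (c c' : Cell) : Prop :=
  ∃ y : ℕ → ℕ,
    (∀ x, c.1 ≤ x → x < c'.1 → c.2 ≤ y x ∧ y x < c'.2 ∧
      ∃ s t, U (x, y x + 1) = some (.be s) ∧ U (x + 1, y x) = some (.be t) ∧ s < t) ∧
    (∀ x x', c.1 ≤ x → x ≤ x' → x' < c'.1 → y x ≤ y x')

theorem CrossingWitness.trans {U : MixedTableau} {c m c' : Cell} (h : CrossingWitness U c m)
    (h' : CrossingWitness U m c') (hm : c.2 < m.2) (hm' : m.2 < c'.2) :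
    CrossingWitness U c c' := by
  obtain ⟨y, hy, hmono⟩ := h
  obtain ⟨y', hy', hmono'⟩ := h'
  refine ⟨fun x => if x < m.1 then y x else y' x, fun x h₁ h₂ => ?_, fun x x' h₁ h₂ h₃ => ?_⟩
  · by_cases hx : x < m.1
    · simp only [hx, if_true]
      obtain ⟨ha, hb, hr⟩ := hy x h₁ hx
      exact ⟨ha, by omega, hr⟩
    · simp only [hx, if_false]
      obtain ⟨ha, hb, hr⟩ := hy' x (by omega) h₂
      exact ⟨by omega, hb, hr⟩
  · by_cases hx : x < m.1 <;> by_cases hx' : x' < m.1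
    · simpa only [hx, hx', if_true] using hmono x x' h₁ h₂ hx'
    · simp only [hx, hx', if_true, if_false]
      have := (hy x h₁ hx).2.1
      have := (hy' x' (by omega) h₃).1
      omega
    · omega
    · simpa only [hx, hx', if_false] using hmono' x x' (by omega) h₂ h₃

/-- The properties of a tableau maintained by the GG-jdt map. -/
structure GGInvariant (U : MixedTableau) : Prop where
  alpha_mono : ∀ c c' p q, U c = some (.al p) → U c' = some (.al q) → c ≤ c' → q ≤ p
  alpha_col : ∀ c c' p, U c = some (.al p) → U c' = some (.al p) → c.2 = c'.2 → c = c'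
  beta_mono : ∀ c c' p q, U c = some (.be p) → U c' = some (.be q) → c ≤ c' → q ≤ p
  beta_row : ∀ c c' p, U c = some (.be p) → U c' = some (.be p) → c.1 = c'.1 → c = c'
  convex : ∀ a x b, U a ≠ none → U b ≠ none → a ≤ x → x ≤ b → U x ≠ none
  pending : ∀ d r, U d = some (.al r) → OutOfOrder U d → ∀ c p, U c = some (.al p) →
    (r < p ∨ p = r ∧ c.2 < d.2) → ∀ e k, U e = some (.be k) → ¬ e ≤ c
  crossing : ∀ d r, U d = some (.al r) → OutOfOrder U d → ∀ c c', U c = some (.al r) →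
    U c' = some (.al r) → c.2 ≤ d.2 → c.1 < c'.1 → c.2 < c'.2 → CrossingWitness U c c'

theorem MixedTableau.exists_of_ne_none {U : MixedTableau} {x : Cell} (h : U x ≠ none) :
    (∃ p, U x = some (.al p)) ∨ ∃ p, U x = some (.be p) := by
  rcases hx : U x with _ | (p | p)
  · exact absurd hx h
  · exact .inl ⟨p, rfl⟩
  · exact .inr ⟨p, rfl⟩

theorem not_crossing_of_no_beta {U : MixedTableau}
    (hmono : ∀ c c' p q, U c = some (.al p) → U c' = some (.al q) → c ≤ c' → q ≤ p)
    (hcol : ∀ c c' p, U c = some (.al p) → U c' = some (.al p) → c.2 = c'.2 → c = c')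
    (hconv : ∀ a x b, U a ≠ none → U b ≠ none → a ≤ x → x ≤ b → U x ≠ none)
    {c c' : Cell} {r : ℤ} (hc : U c = some (.al r)) (hc' : U c' = some (.al r))
    (hno : ∀ e k, U e = some (.be k) → ¬ e ≤ c') (h₁ : c.1 < c'.1) (h₂ : c.2 ≤ c'.2) : False := by
  have hl : c ≤ (c'.1, c.2) := ⟨h₁.le, le_rfl⟩
  have hr : (c'.1, c.2) ≤ c' := ⟨le_rfl, h₂⟩
  rcases MixedTableau.exists_of_ne_none
    (hconv c (c'.1, c.2) c' (by simp [hc]) (by simp [hc']) hl hr) with ⟨p, hp⟩ | ⟨p, hp⟩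
  · have hpr : p = r := le_antisymm (hmono _ _ _ _ hc hp hl) (hmono _ _ _ _ hp hc' hr)
    subst hpr
    have := congrArg Prod.fst (hcol _ _ _ hc hp rfl)
    simp only at this
    omega
  · exact hno _ _ hp hr

theorem GGInvariant.of_sorted {T : MixedTableau} (ha : AlphaColumnStrict T) (hb : BetaRowStrict T)
    (hs : ABSorted T) : GGInvariant T := by
  obtain ⟨hα, hα'⟩ := alphaColumnStrict_iff.1 ha
  obtain ⟨hβ, hβ'⟩ := betaRowStrict_iff.1 hb
  obtain ⟨lam, mu, ⟨hlam, hmu, -, hsh⟩, nu, hnu, -, -, hA, hB⟩ := hs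
  have hno : ∀ c p, T c = some (.al p) → ∀ e k, T e = some (.be k) → ¬ e ≤ c := by
    intro c p hc e k he hle
    have hc' : c ∈ nu \ lam := hA ▸ ⟨p, hc⟩
    have he' : e ∈ mu \ nu := hB ▸ ⟨k, he⟩
    have hpos := hmu.2.1 e he'.1
    exact he'.2 (hnu.2.2 c.1 c.2 e.1 e.2 hc'.1 hpos.1 hle.1 hpos.2 hle.2)
  have hconv : ∀ a x b, T a ≠ none → T b ≠ none → a ≤ x → x ≤ b → T x ≠ none := by
    intro a x b h₁ h₂ hax hxb
    have h₁' : a ∈ mu \ lam := hsh ▸ h₁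
    have h₂' : b ∈ mu \ lam := hsh ▸ h₂
    have hpos := hmu.2.1 a h₁'.1
    have hx : x ∈ mu \ lam :=
      ⟨hmu.2.2 b.1 b.2 x.1 x.2 h₂'.1 (hpos.1.trans hax.1) hxb.1 (hpos.2.trans hax.2) hxb.2,
        fun h => h₁'.2 (hlam.2.2 x.1 x.2 a.1 a.2 h hpos.1 hax.1 hpos.2 hax.2)⟩
    rw [← hsh] at hx
    exact hx
  exact ⟨hα, hα', hβ, hβ', hconv, fun _ _ _ _ c p hc _ => hno c p hc,
    fun _ _ _ _ c c' hc hc' _ h₁ h₂ =>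
      (not_crossing_of_no_beta hα hα' hconv hc hc' (hno c' _ hc') h₁ h₂.le).elim⟩

theorem swapCells_apply (U : MixedTableau) (c m x : Cell) :
    swapCells U c m x = if x = m then U c else if x = c then U m else U x := by
  simp only [swapCells, Function.update_apply]

/-- All `α` entries preceding `α_r` in column `j` in the order of treatment are in order. -/
def SettledBefore (U : MixedTableau) (r : ℤ) (j : ℕ) : Prop :=
  ∀ c q, U c = some (.al q) → (q < r ∨ q = r ∧ j < c.2) → ¬ OutOfOrder U c

theorem SettledBefore.of_chosen {U : MixedTableau} {c : Cell} {r : ℤ} (h : GGChosen U c)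
    (hc : U c = some (.al r)) : SettledBefore U r c.2 := by
  obtain ⟨r', hr', -, h₁, h₂⟩ := h
  obtain rfl : r' = r := by simpa [hc] using hr'.symm
  intro d q hd hq hO
  rcases hq with hq | ⟨rfl, hq⟩
  · exact absurd (h₁ d q hd hO) (not_le.2 hq)
  · exact absurd (h₂ d hd hO) (not_le.2 hq)

theorem le_of_not_outOfOrder_right {U : MixedTableau} {k l : ℕ} {p s : ℤ}
    (h : ¬ OutOfOrder U (k, l)) (hp : U (k, l) = some (.al p))
    (hs : U (k, l + 1) = some (.be s)) : s + (l + 1) - k ≤ p := by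
  by_contra hlt
  exact h (.inl ⟨p, s, hp, hs, by push Not at hlt; simpa [add_assoc] using hlt⟩)

theorem lt_of_not_outOfOrder_up {U : MixedTableau} {k l : ℕ} {p s : ℤ}
    (h : ¬ OutOfOrder U (k, l)) (hp : U (k, l) = some (.al p))
    (hs : U (k + 1, l) = some (.be s)) : s + l - (k + 1) < p := by
  by_contra hlt
  exact h (.inr ⟨p, s, hp, hs, by push Not at hlt; simpa using hlt⟩)

namespace GGInvariant

variable {U : MixedTableau} {r : ℤ} {j : ℕ}

theorem beta_above_bound (hU : GGInvariant U) (hset : SettledBefore U r j) {l : ℕ} {s : ℤ}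
    {n : ℕ} : ∀ {k : ℕ} {p : ℤ}, U (k, l) = some (.al p) → (p < r ∨ p = r ∧ j < l) →
      U (k + n + 1, l) = some (.be s) → s + l - k ≤ p := by
  induction n with
  | zero =>
    intro k p hp hpr hs
    have := lt_of_not_outOfOrder_up (hset _ _ hp hpr) hp hs
    omega
  | succ n ih =>
    intro k p hp hpr hs
    have hle : ((k + 1, l) : Cell) ≤ (k + (n + 1) + 1, l) := ⟨by simp only; omega, le_rfl⟩
    have hle' : ((k, l) : Cell) ≤ (k + 1, l) := ⟨by simp only; omega, le_rfl⟩
    rcases MixedTableau.exists_of_ne_none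
      (hU.convex _ _ _ (by simp [hp]) (by simp [hs]) hle' hle) with ⟨q, hq⟩ | ⟨q, hq⟩
    · have hqp := hU.alpha_mono _ _ _ _ hp hq hle'
      have hne : q ≠ p := by
        rintro rfl
        simpa using hU.alpha_col _ _ _ hp hq rfl
      have := ih hq (by omega) (by rw [← hs]; congr 2; omega)
      push_cast at this
      omega
    · have h₁ := lt_of_not_outOfOrder_up (hset _ _ hp hpr) hp hq
      have h₂ := hU.beta_mono _ _ _ _ hq hs hle
      omega

theorem beta_right_bound (hU : GGInvariant U) (hset : SettledBefore U r j) {k l : ℕ} {p : ℤ}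
    (hp : U (k, l) = some (.al p)) (hpr : p < r ∨ p = r ∧ j < l) {n : ℕ} :
    ∀ {s : ℤ}, U (k, l + n + 1) = some (.be s) → s + (l + n + 1) - k ≤ p := by
  induction n with
  | zero =>
    intro s hs
    have := le_of_not_outOfOrder_right (hset _ _ hp hpr) hp hs
    simpa using this
  | succ n ih =>
    intro s hs
    have hle : ((k, l + n + 1) : Cell) ≤ (k, l + (n + 1) + 1) := ⟨le_rfl, by simp only; omega⟩
    have hle' : ((k, l) : Cell) ≤ (k, l + n + 1) := ⟨le_rfl, by simp only; omega⟩
    rcases MixedTableau.exists_of_ne_none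
      (hU.convex _ _ _ (by simp [hp]) (by simp [hs]) hle' hle) with ⟨q, hq⟩ | ⟨q, hq⟩
    · have hqp := hU.alpha_mono _ _ _ _ hp hq hle'
      have := le_of_not_outOfOrder_right
        (hset _ _ hq (by simp only; omega)) hq (by rw [← hs]; rfl)
      push_cast at this ⊢
      omega
    · have h₁ := ih hq
      have h₂ := hU.beta_mono _ _ _ _ hq hs hle
      have hne : s ≠ q := by
        rintro rfl
        simpa using hU.beta_row _ _ _ hq hs rfl
      push_cast
      omega

/-- An entry out of order after a slide is the moved one, or it comes later in the order of
treatment. -/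
theorem outOfOrder_swap (hU : GGInvariant U) {c m d : Cell} {p s : ℤ}
    (hset : SettledBefore U r c.2) (hc : U c = some (.al r)) (hm : U m = some (.be s))
    (hd : swapCells U c m d = some (.al p)) (hO : OutOfOrder (swapCells U c m) d) :
    d = m ∨ r < p ∨ p = r ∧ d.2 < c.2 := by
  by_cases hdm : d = m
  · exact .inl hdm
  right
  have hdc : d ≠ c := by
    rintro rfl
    simp [swapCells_apply, hdm, hm] at hd
  have hUd : U d = some (.al p) := by simpa [swapCells_apply, hdm, hdc] using hd
  have hnext : ∀ n k, swapCells U c m n = some (.be k) → n = c ∨ U n = some (.be k) := by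
    intro n k hn
    by_cases hnc : n = c
    · exact .inl hnc
    · by_cases hnm : n = m
      · simp [swapCells_apply, hnm, hc] at hn
      · exact .inr (by simpa [swapCells_apply, hnc, hnm] using hn)
  have hcase : OutOfOrder U d ∨ d ≤ c := by
    rcases hO with ⟨r', k, h₁, h₂, h₃⟩ | ⟨r', k, h₁, h₂, h₃⟩
    · obtain rfl : r' = p := by simpa [hd] using h₁.symm
      rcases hnext _ _ h₂ with h | h
      · exact .inr (h ▸ ⟨le_rfl, Nat.le_succ _⟩)
      · exact .inl (.inl ⟨_, _, hUd, h, h₃⟩)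
    · obtain rfl : r' = p := by simpa [hd] using h₁.symm
      rcases hnext _ _ h₂ with h | h
      · exact .inr (h ▸ ⟨Nat.le_succ _, le_rfl⟩)
      · exact .inl (.inr ⟨_, _, hUd, h, h₃⟩)
  have hne : p = r → d.2 ≠ c.2 := by
    rintro rfl h
    exact hdc (hU.alpha_col _ _ _ hUd hc h)
  rcases hcase with h | h
  · have := hset d p hUd
    by_contra hcon
    exact this (by omega) h
  · have h₁ := hU.alpha_mono _ _ _ _ hUd hc h
    have h₂ := h.2
    omega

/-- A slide preserves the invariant once it preserves strictness and produces the witnesses for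
the pairs involving the moved entry. -/
theorem swap (hU : GGInvariant U) {c m : Cell} {s : ℤ}
    (hset : SettledBefore U r c.2) (hO : OutOfOrder U c) (hc : U c = some (.al r))
    (hm : U m = some (.be s)) (hcm : m.2 = c.2 ∨ m.2 = c.2 + 1)
    (ha : AlphaColumnStrict (swapCells U c m)) (hb : BetaRowStrict (swapCells U c m))
    (hleft : ∀ c', U c' = some (.al r) → m.1 < c'.1 → m.2 < c'.2 →
      CrossingWitness (swapCells U c m) m c')
    (hright : ∀ d, U d = some (.al r) → d.1 < m.1 → d.2 < c.2 →
      CrossingWitness (swapCells U c m) d m) :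
    GGInvariant (swapCells U c m) := by
  obtain ⟨hα, hα'⟩ := alphaColumnStrict_iff.1 ha
  obtain ⟨hβ, hβ'⟩ := betaRowStrict_iff.1 hb
  have hmc : m ≠ c := by
    rintro rfl
    simp [hc] at hm
  have hvm : swapCells U c m m = some (.al r) := by simp [swapCells_apply, hc]
  have hvc : swapCells U c m c = some (.be s) := by simp [swapCells_apply, hmc.symm, hm]
  have hback : ∀ d p, d ≠ m → swapCells U c m d = some (.al p) → U d = some (.al p) ∧ d ≠ c := by
    intro d p hdm hd
    have hdc : d ≠ c := by
      rintro rfl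
      simp [hvc] at hd
    exact ⟨by simpa [swapCells_apply, hdm, hdc] using hd, hdc⟩
  have hconv : ∀ a x b, swapCells U c m a ≠ none → swapCells U c m b ≠ none → a ≤ x → x ≤ b →
      swapCells U c m x ≠ none := by
    have hiff : ∀ x, swapCells U c m x ≠ none ↔ U x ≠ none := by
      intro x
      rw [swapCells_apply]
      split_ifs with h₁ h₂
      · simp [h₁, hc, hm]
      · simp [h₂, hc, hm]
      · rfl
    intro a x b
    rw [hiff, hiff, hiff]
    exact hU.convex a x b
  have hcol : ∀ d, d ≠ m → swapCells U c m d = some (.al r) → d.2 ≤ m.2 → d.2 < c.2 := by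
    intro d hdm hd hle
    obtain ⟨hd', hdc⟩ := hback d r hdm hd
    have h₁ : d.2 ≠ c.2 := fun h => hdc (hU.alpha_col _ _ _ hd' hc h)
    have h₂ : d.2 ≠ m.2 := fun h => hdm (hα' _ _ _ hd hvm h)
    omega
  have hpend : ∀ d p, d ≠ m → swapCells U c m d = some (.al p) → (r < p ∨ p = r ∧ d.2 < c.2) →
      ∀ e k, swapCells U c m e = some (.be k) → ¬ e ≤ d := by
    intro d p hdm hd hlt e k he hed
    obtain ⟨hd', hdc⟩ := hback d p hdm hd
    by_cases hec : e = c
    · subst hec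
      have := hU.alpha_mono _ _ _ _ hc hd' hed
      have := hed.2
      omega
    · have hem : e ≠ m := by
        rintro rfl
        simp [hvm] at he
      exact hU.pending c r hc hO d p hd' hlt e k
        (by simpa [swapCells_apply, hec, hem] using he) hed
  refine ⟨hα, hα', hβ, hβ', hconv, ?_, ?_⟩
  · intro d p hd hOd d' p' hd' hlt
    have hd'm : d' ≠ m := by
      rintro rfl
      obtain rfl : r = p' := by simpa [hvm] using hd'
      rcases hU.outOfOrder_swap hset hc hm hd hOd with rfl | h | h
      · obtain rfl : r = p := by simpa [hvm] using hd
        omega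
      · omega
      · omega
    refine hpend d' p' hd'm hd' ?_
    rcases hU.outOfOrder_swap hset hc hm hd hOd with rfl | h | h
    · obtain rfl : r = p := by simpa [hvm] using hd
      rcases hlt with h | ⟨rfl, h⟩
      · exact .inl h
      · exact .inr ⟨rfl, hcol _ hd'm hd' h.le⟩
    · omega
    · omega
  · intro d p hd hOd d₁ d₂ h₁ h₂ hle hrow hcl
    rcases lt_or_ge r p with hlt | hge
    · have h₂m : d₂ ≠ m := by
        rintro rfl
        obtain rfl : r = p := by simpa [hvm] using h₂
        omega
      exact (not_crossing_of_no_beta hα hα' hconv h₁ h₂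
        (hpend _ _ h₂m h₂ (.inl hlt)) hrow hcl.le).elim
    obtain ⟨rfl, hd₁⟩ : p = r ∧ (d₁ = m ∨ d₁.2 < c.2) := by
      rcases hU.outOfOrder_swap hset hc hm hd hOd with rfl | h | h
      · obtain rfl : r = p := by simpa [hvm] using hd
        refine ⟨rfl, or_iff_not_imp_left.2 fun h => hcol _ h h₁ hle⟩
      · omega
      · exact ⟨h.1, .inr (by omega)⟩
    by_cases h₁m : d₁ = m
    · subst h₁m
      have h₂m : d₂ ≠ d₁ := by
        rintro rfl
        omega
      exact hleft _ (hback _ _ h₂m h₂).1 hrow hcl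
    have h₁c : d₁.2 < c.2 := hd₁.resolve_left h₁m
    by_cases h₂m : d₂ = m
    · subst h₂m
      exact hright _ (hback _ _ h₁m h₁).1 hrow h₁c
    by_cases h₂d : d₂.2 < m.2
    · exact (not_crossing_of_no_beta hα hα' hconv h₁ h₂
        (hpend _ _ h₂m h₂ (.inr ⟨rfl, hcol _ h₂m h₂ h₂d.le⟩)) hrow hcl.le).elim
    have h₂ne : d₂.2 ≠ m.2 := fun h => h₂m (hα' _ _ _ h₂ hvm h)
    by_cases hr₁ : d₁.1 < m.1
    · have w := hright _ (hback _ _ h₁m h₁).1 hr₁ h₁c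
      by_cases hr₂ : m.1 < d₂.1
      · exact w.trans (hleft _ (hback _ _ h₂m h₂).1 hr₂ (by omega)) (by omega) (by omega)
      · obtain ⟨y, hy, hmono⟩ := w
        refine ⟨y, fun x hx hx' => ?_, fun x x' hx hxx hx' => hmono x x' hx hxx (by omega)⟩
        obtain ⟨ha, hb, hr⟩ := hy x hx (by omega)
        exact ⟨ha, by omega, hr⟩
    · obtain ⟨y, hy, hmono⟩ := hleft _ (hback _ _ h₂m h₂).1 (by omega) (by omega)
      refine ⟨y, fun x hx hx' => ?_, fun x x' hx hxx hx' => hmono x x' (by omega) hxx hx'⟩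
      obtain ⟨ha, hb, hr⟩ := hy x (by omega) hx'
      exact ⟨by omega, hb, hr⟩

/-- A swap preserves `α`-column-strictness if the moved `α` entry fits at its new position. -/
theorem alphaColumnStrict_swap (hU : GGInvariant U) {c m : Cell} {s : ℤ}
    (hc : U c = some (.al r)) (hm : U m = some (.be s)) (hcm : c ≤ m)
    (hsw : ∀ d q, U d = some (.al q) → d ≤ m → d ≠ c → r ≤ q)
    (hcol : ∀ d, U d = some (.al r) → d.2 = m.2 → d = c) :
    AlphaColumnStrict (swapCells U c m) := by
  have key : ∀ d p, swapCells U c m d = some (.al p) →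
      (d = m ∧ p = r) ∨ (U d = some (.al p) ∧ d ≠ c) := by
    intro d p hd
    rw [swapCells_apply] at hd
    split_ifs at hd with h₁ h₂
    · exact .inl ⟨h₁, by simpa [hc] using hd.symm⟩
    · simp [hm] at hd
    · exact .inr ⟨hd, h₂⟩
  refine alphaColumnStrict_iff.2 ⟨fun d d' p q hd hd' hle => ?_, fun d d' p hd hd' he => ?_⟩
  · rcases key d p hd with ⟨rfl, rfl⟩ | ⟨hdU, hdc⟩ <;>
      rcases key d' q hd' with ⟨rfl, rfl⟩ | ⟨hd', hdc'⟩
    · exact le_rfl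
    · exact hU.alpha_mono _ _ _ _ hc hd' (hcm.trans hle)
    · exact hsw d p hdU hle hdc
    · exact hU.alpha_mono _ _ _ _ hdU hd' hle
  · rcases key d p hd with ⟨rfl, rfl⟩ | ⟨hdU, hdc⟩ <;>
      rcases key d' _ hd' with ⟨rfl, h⟩ | ⟨hd', hdc'⟩
    · rfl
    · exact absurd (hcol d' hd' he.symm) hdc'
    · subst h
      exact absurd (hcol d hdU he) hdc
    · exact hU.alpha_col _ _ _ hdU hd' he

/-- A swap preserves `β`-row-strictness if the moved `β` entry fits at its new position. -/
theorem betaRowStrict_swap (hU : GGInvariant U) {c m : Cell} {s : ℤ}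
    (hc : U c = some (.al r)) (hm : U m = some (.be s)) (hcm : c ≤ m)
    (hne : ∀ d q, U d = some (.be q) → c ≤ d → d ≠ m → q ≤ s)
    (hrow : ∀ d, U d = some (.be s) → d.1 = c.1 → d = m) :
    BetaRowStrict (swapCells U c m) := by
  have key : ∀ d p, swapCells U c m d = some (.be p) →
      (d = c ∧ p = s) ∨ (U d = some (.be p) ∧ d ≠ m) := by
    intro d p hd
    rw [swapCells_apply] at hd
    split_ifs at hd with h₁ h₂
    · simp [hc] at hd
    · exact .inl ⟨h₂, by simpa [hm] using hd.symm⟩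
    · exact .inr ⟨hd, h₁⟩
  refine betaRowStrict_iff.2 ⟨fun d d' p q hd hd' hle => ?_, fun d d' p hd hd' he => ?_⟩
  · rcases key d p hd with ⟨rfl, rfl⟩ | ⟨hdU, hdc⟩ <;>
      rcases key d' q hd' with ⟨rfl, rfl⟩ | ⟨hd', hdc'⟩
    · exact le_rfl
    · exact hne d' q hd' hle hdc'
    · exact hU.beta_mono _ _ _ _ hdU hm (hle.trans hcm)
    · exact hU.beta_mono _ _ _ _ hdU hd' hle
  · rcases key d p hd with ⟨rfl, rfl⟩ | ⟨hdU, hdc⟩ <;>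
      rcases key d' _ hd' with ⟨rfl, h⟩ | ⟨hd', hdc'⟩
    · rfl
    · exact absurd (hrow d' hd' he.symm) hdc'
    · subst h
      exact absurd (hrow d hdU he) hdc
    · exact hU.beta_row _ _ _ hdU hd' he

/-- A horizontal slide preserves strictness and the invariant. -/
theorem swap_right (hU : GGInvariant U) {i j : ℕ} {s : ℤ} (hset : SettledBefore U r j)
    (hO : OutOfOrder U (i, j)) (hc : U (i, j) = some (.al r)) (hm : U (i, j + 1) = some (.be s))
    (hlt : r < s + (j + 1) - i) (hup : ∀ t, U (i + 1, j) = some (.be t) → t ≤ s) :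
    AlphaColumnStrict (swapCells U (i, j) (i, j + 1)) ∧
      BetaRowStrict (swapCells U (i, j) (i, j + 1)) ∧
      GGInvariant (swapCells U (i, j) (i, j + 1)) := by
  have hcross : ∀ {i' y}, U (i', y) = some (.al r) → i < i' → j < y →
      ∃ f : ℕ → ℕ, (∀ x, i ≤ x → x < i' → j + 1 ≤ f x ∧ f x < y ∧
        ∃ s t, U (x, f x + 1) = some (.be s) ∧ U (x + 1, f x) = some (.be t) ∧ s < t) ∧
      (∀ x x', i ≤ x → x ≤ x' → x' < i' → f x ≤ f x') := by
    intro i' y h hi hy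
    obtain ⟨f, hf, hmono⟩ := hU.crossing _ _ hc hO _ _ hc h le_rfl hi hy
    simp only at hf hmono
    have hne : f i ≠ j := by
      intro he
      obtain ⟨-, -, s', t, hs', ht, hst⟩ := hf i le_rfl hi
      rw [he] at hs' ht
      obtain rfl : s = s' := by simpa [hm] using hs'
      exact absurd (hup t ht) (not_le.2 hst)
    have hgt : j + 1 ≤ f i := by
      have := (hf i le_rfl hi).1
      omega
    exact ⟨f, fun x hx hx' =>
      ⟨hgt.trans (hmono i x le_rfl hx hx'), (hf x hx hx').2⟩, hmono⟩
  have hbelow : ∀ k q, U (k, j + 1) = some (.al q) → k ≤ i → r < q := by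
    intro k q hq hk
    by_contra hqr
    have hki : k ≠ i := by
      rintro rfl
      simp [hm] at hq
    obtain ⟨n, rfl⟩ : ∃ n, i = k + n + 1 := ⟨i - k - 1, by omega⟩
    have := hU.beta_above_bound hset hq (by omega) hm
    push_cast at hlt
    omega
  have habove : ∀ k t, U (k, j) = some (.be t) → i ≤ k → t ≤ s := by
    intro k t ht hk
    have hki : k ≠ i := by
      rintro rfl
      simp [hc] at ht
    have hle : ((i, j) : Cell) ≤ (i + 1, j) := ⟨Nat.le_succ _, le_rfl⟩
    have hle' : ((i + 1, j) : Cell) ≤ (k, j) := ⟨by simp only; omega, le_rfl⟩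
    rcases MixedTableau.exists_of_ne_none
      (hU.convex _ _ _ (by simp [hc]) (by simp [ht]) hle hle') with ⟨q, hq⟩ | ⟨q, hq⟩
    · have hqr := hU.alpha_mono _ _ _ _ hc hq hle
      have hne : q ≠ r := by
        rintro rfl
        simpa using hU.alpha_col _ _ _ hc hq rfl
      have hkne : k ≠ i + 1 := by
        rintro rfl
        simp [hq] at ht
      obtain ⟨n, rfl⟩ : ∃ n, k = i + 1 + n + 1 := ⟨k - i - 2, by omega⟩
      have := hU.beta_above_bound hset hq (by omega) ht
      push_cast at this
      omega
    · exact (hU.beta_mono _ _ _ _ hq ht hle').trans (hup q hq)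
  have ha : AlphaColumnStrict (swapCells U (i, j) (i, j + 1)) := by
    refine hU.alphaColumnStrict_swap hc hm ⟨le_rfl, Nat.le_succ _⟩ ?_ ?_
    · rintro ⟨k, l⟩ q hq ⟨hk, hl⟩ -
      simp only at hk hl
      rcases Nat.lt_or_ge j l with hjl | hjl
      · obtain rfl : l = j + 1 := by omega
        exact (hbelow k q hq hk).le
      · exact hU.alpha_mono _ _ _ _ hq hc ⟨hk, hjl⟩
    · rintro ⟨k, l⟩ hq hl
      simp only at hl
      subst hl
      rcases Nat.lt_or_ge i k with hik | hik
      · obtain ⟨f, hf, -⟩ := hcross hq hik (Nat.lt_succ_self j)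
        have := hf i le_rfl hik
        omega
      · exact absurd (hbelow k r hq hik) (lt_irrefl r)
  have hb : BetaRowStrict (swapCells U (i, j) (i, j + 1)) := by
    refine hU.betaRowStrict_swap hc hm ⟨le_rfl, Nat.le_succ _⟩ ?_
      (fun d hd he => hU.beta_row _ _ _ hd hm he)
    rintro ⟨k, l⟩ q hq ⟨hk, hl⟩ -
    simp only at hk hl
    rcases Nat.lt_or_ge j l with hjl | hjl
    · exact hU.beta_mono _ _ _ _ hm hq ⟨hk, hjl⟩
    · obtain rfl : l = j := by omega
      exact habove k q hq hk
  refine ⟨ha, hb, hU.swap hset hO hc hm (.inr rfl) ha hb ?_ ?_⟩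
  · rintro ⟨i', y⟩ h hi hy
    simp only at hi hy
    obtain ⟨f, hf, hmono⟩ := hcross h hi (by omega)
    refine ⟨f, fun x hx hx' => ?_, hmono⟩
    obtain ⟨h₁, h₂, s', t, hs', ht, hst⟩ := hf x hx hx'
    refine ⟨h₁, h₂, s', t, ?_, ?_, hst⟩
    · rw [swapCells_apply, if_neg, if_neg, hs'] <;>
      · rw [Prod.mk.injEq]
        omega
    · rw [swapCells_apply, if_neg, if_neg, ht] <;>
      · rw [Prod.mk.injEq]
        simp only at hx
        omega
  · rintro ⟨i', y⟩ h hi hy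
    simp only at hi hy
    obtain ⟨f, hf, hmono⟩ := hU.crossing _ _ hc hO _ _ h hc hy.le hi hy
    refine ⟨f, fun x hx hx' => ?_, hmono⟩
    simp only at hx'
    obtain ⟨h₁, h₂, s', t, hs', ht, hst⟩ := hf x hx hx'
    simp only at h₁ h₂
    refine ⟨h₁, by simp only; omega, s', t, ?_, ?_, hst⟩
    · rw [swapCells_apply, if_neg, if_neg, hs'] <;>
      · rw [Prod.mk.injEq]
        omega
    · rw [swapCells_apply, if_neg, if_neg, ht] <;>
      · rw [Prod.mk.injEq]
        omega

/-- A vertical slide preserves strictness and the invariant. -/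
theorem swap_up (hU : GGInvariant U) {i j : ℕ} {t : ℤ} (hset : SettledBefore U r j)
    (hO : OutOfOrder U (i, j)) (hc : U (i, j) = some (.al r)) (hm : U (i + 1, j) = some (.be t))
    (hlt : r ≤ t + j - (i + 1)) (hrt : ∀ s, U (i, j + 1) = some (.be s) → s < t) :
    AlphaColumnStrict (swapCells U (i, j) (i + 1, j)) ∧
      BetaRowStrict (swapCells U (i, j) (i + 1, j)) ∧
      GGInvariant (swapCells U (i, j) (i + 1, j)) := by
  have hleftα : ∀ k q, U (i + 1, k) = some (.al q) → k < j → r ≤ q := by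
    intro k q hq hk
    by_contra hqr
    obtain ⟨n, rfl⟩ : ∃ n, j = k + n + 1 := ⟨j - k - 1, by omega⟩
    have := hU.beta_right_bound hset hq (by omega) hm
    push_cast at hlt this
    omega
  have hright : ∀ k s, U (i, k) = some (.be s) → j ≤ k → s < t := by
    intro k s hs hk
    have hkj : k ≠ j := by
      rintro rfl
      simp [hc] at hs
    have hle : ((i, j) : Cell) ≤ (i, j + 1) := ⟨le_rfl, Nat.le_succ _⟩
    have hle' : ((i, j + 1) : Cell) ≤ (i, k) := ⟨le_rfl, by simp only; omega⟩
    rcases MixedTableau.exists_of_ne_none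
      (hU.convex _ _ _ (by simp [hc]) (by simp [hs]) hle hle') with ⟨q, hq⟩ | ⟨q, hq⟩
    · have hqr := hU.alpha_mono _ _ _ _ hc hq hle
      have hkne : k ≠ j + 1 := by
        rintro rfl
        simp [hq] at hs
      obtain ⟨n, rfl⟩ : ∃ n, k = j + 1 + n + 1 := ⟨k - j - 2, by omega⟩
      have := hU.beta_right_bound hset hq (by omega) hs
      push_cast at this
      omega
    · exact (hU.beta_mono _ _ _ _ hq hs hle').trans_lt (hrt q hq)
  have hleftβ : ∀ k s, U (i, k) = some (.be s) → k < j → s ≠ t := by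
    rintro k s hs hk rfl
    have hle : ((i, k) : Cell) ≤ (i + 1, k) := ⟨Nat.le_succ _, le_rfl⟩
    have hle' : ((i + 1, k) : Cell) ≤ (i + 1, j) := ⟨le_rfl, hk.le⟩
    rcases MixedTableau.exists_of_ne_none
      (hU.convex _ _ _ (by simp [hs]) (by simp [hm]) hle hle') with ⟨q, hq⟩ | ⟨q, hq⟩
    · have := hleftα k q hq hk
      refine hU.pending _ _ hc hO _ _ hq ?_ _ _ hs hle
      simp only
      omega
    · obtain rfl : q = s :=
        le_antisymm (hU.beta_mono _ _ _ _ hs hq hle) (hU.beta_mono _ _ _ _ hq hm hle')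
      have := congrArg Prod.snd (hU.beta_row _ _ _ hq hm rfl)
      simp only at this
      omega
  have ha : AlphaColumnStrict (swapCells U (i, j) (i + 1, j)) := by
    refine hU.alphaColumnStrict_swap hc hm ⟨Nat.le_succ _, le_rfl⟩ ?_
      (fun d hd he => hU.alpha_col _ _ _ hd hc he)
    rintro ⟨k, l⟩ q hq ⟨hk, hl⟩ -
    simp only at hk hl
    rcases Nat.lt_or_ge i k with hik | hik
    · obtain rfl : k = i + 1 := by omega
      refine hleftα l q hq (lt_of_le_of_ne hl ?_)
      rintro rfl
      simp [hm] at hq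
    · exact hU.alpha_mono _ _ _ _ hq hc ⟨hik, hl⟩
  have hb : BetaRowStrict (swapCells U (i, j) (i + 1, j)) := by
    refine hU.betaRowStrict_swap hc hm ⟨Nat.le_succ _, le_rfl⟩ ?_ ?_
    · rintro ⟨k, l⟩ q hq ⟨hk, hl⟩ -
      simp only at hk hl
      rcases Nat.lt_or_ge i k with hik | hik
      · exact hU.beta_mono _ _ _ _ hm hq ⟨hik, hl⟩
      · obtain rfl : k = i := by omega
        exact (hright l q hq hl).le
    · rintro ⟨k, l⟩ hq hk
      simp only at hk
      subst hk
      rcases Nat.lt_or_ge l j with hlj | hlj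
      · exact absurd rfl (hleftβ l t hq hlj)
      · exact absurd (hright l t hq hlj) (lt_irrefl t)
  refine ⟨ha, hb, hU.swap hset hO hc hm (.inl rfl) ha hb ?_ ?_⟩
  · rintro ⟨i', y⟩ h hi hy
    simp only at hi hy
    obtain ⟨f, hf, hmono⟩ := hU.crossing _ _ hc hO _ _ hc h le_rfl
      (by simp only; omega) hy
    refine ⟨f, fun x hx hx' => ?_, fun x x' hx => hmono x x' (by simp only at hx ⊢; omega)⟩
    simp only at hx hx'
    obtain ⟨h₁, h₂, s', t', hs', ht', hst⟩ := hf x (by simp only; omega) hx'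
    simp only at h₁ h₂
    refine ⟨h₁, h₂, s', t', ?_, ?_, hst⟩
    · rw [swapCells_apply, if_neg, if_neg, hs'] <;>
      · rw [Prod.mk.injEq]
        omega
    · rw [swapCells_apply, if_neg, if_neg, ht'] <;>
      · rw [Prod.mk.injEq]
        omega
  · rintro ⟨p, q⟩ h hp hq
    simp only at hp hq
    obtain ⟨f, hf, hmono⟩ : ∃ f : ℕ → ℕ, (∀ x, p ≤ x → x < i → q ≤ f x ∧ f x + 1 ≤ j ∧
        ∃ s t, U (x, f x + 1) = some (.be s) ∧ U (x + 1, f x) = some (.be t) ∧ s < t) ∧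
        (∀ x x', p ≤ x → x ≤ x' → x' < i → f x ≤ f x') := by
      by_cases hpi : p < i
      · exact hU.crossing _ _ hc hO _ _ h hc hq.le hpi hq
      · exact ⟨id, fun x _ _ => by omega, fun x x' _ _ _ => by omega⟩
    obtain ⟨j, rfl⟩ : ∃ l, j = l + 1 := ⟨j - 1, by omega⟩
    obtain ⟨w, hw, hwt⟩ : ∃ w, U (i + 1, j) = some (.be w) ∧ t < w := by
      have hle : ((p, q) : Cell) ≤ (i + 1, j) := ⟨by simp only; omega, by simp only; omega⟩
      have hle' : ((i + 1, j) : Cell) ≤ (i + 1, j + 1) := ⟨le_rfl, Nat.le_succ _⟩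
      rcases MixedTableau.exists_of_ne_none
        (hU.convex _ _ _ (by simp [h]) (by simp [hm]) hle hle') with ⟨a, ha'⟩ | ⟨w, hw⟩
      · have h₁ := hU.alpha_mono _ _ _ _ h ha' hle
        obtain rfl : a = r := le_antisymm h₁ (hleftα j a ha' (Nat.lt_succ_self j))
        exact (not_crossing_of_no_beta hU.alpha_mono hU.alpha_col hU.convex h ha'
          (hU.pending _ _ hc hO _ _ ha' (.inr ⟨rfl, Nat.lt_succ_self j⟩))
          (by simp only; omega) (by simp only; omega)).elim
      · refine ⟨w, hw, lt_of_le_of_ne (hU.beta_mono _ _ _ _ hw hm hle') ?_⟩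
        rintro rfl
        simpa using hU.beta_row _ _ _ hw hm rfl
    refine ⟨fun x => if x < i then f x else j, fun x hx hx' => ?_,
      fun x x' hx hxx hx' => ?_⟩
    · simp only at hx hx'
      by_cases hxi : x < i
      · simp only [hxi, if_true]
        obtain ⟨h₁, h₂, s', t', hs', ht', hst⟩ := hf x hx hxi
        refine ⟨h₁, by omega, s', t', ?_, ?_, hst⟩
        · rw [swapCells_apply, if_neg, if_neg, hs'] <;>
          · rw [Prod.mk.injEq]
            omega
        · rw [swapCells_apply, if_neg, if_neg, ht'] <;>
          · rw [Prod.mk.injEq]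
            omega
      · simp only [hxi, if_false]
        obtain rfl : x = i := by omega
        exact ⟨by omega, by omega, t, w, by simp [swapCells_apply, hm],
          by simp [swapCells_apply, hw], hwt⟩
    · simp only at hx hx'
      by_cases hxi : x < i <;> by_cases hxi' : x' < i
      · simpa only [hxi, hxi', if_true] using hmono x x' hx hxx hxi'
      · simp only [hxi, hxi', if_true, if_false]
        have := (hf x hx hxi).2.1
        omega
      · omega
      · simp only [hxi, hxi', if_false, le_refl]

end GGInvariant

theorem GGInvariant.step {U U' : MixedTableau} (hU : GGInvariant U) (h : GGStep U U') :
    AlphaColumnStrict U' ∧ BetaRowStrict U' ∧ GGInvariant U' := by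
  obtain ⟨⟨i, j⟩, hch, hsl⟩ := h
  obtain ⟨r, hc, hO, -⟩ := id hch
  have hset := SettledBefore.of_chosen hch hc
  simp only at hset
  have hH : ∀ s, U (i, j + 1) = some (.be s) → (OutOfOrderH U (i, j) ↔ r < s + (j + 1) - i) := by
    intro s hs
    constructor
    · rintro ⟨r', s', h₁, h₂, h₃⟩
      obtain rfl : r = r' := by simpa [hc] using h₁
      obtain rfl : s = s' := by simpa [rtCell, hs] using h₂
      exact h₃
    · exact fun h => ⟨r, s, hc, hs, h⟩
  have hV : ∀ t, U (i + 1, j) = some (.be t) → (OutOfOrderV U (i, j) ↔ r ≤ t + j - (i + 1)) := by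
    intro s hs
    constructor
    · rintro ⟨r', s', h₁, h₂, h₃⟩
      obtain rfl : r = r' := by simpa [hc] using h₁
      obtain rfl : s = s' := by simpa [upCell, hs] using h₂
      exact h₃
    · exact fun h => ⟨r, s, hc, hs, h⟩
  rcases hsl with ⟨h₁, h₂, rfl⟩ | ⟨h₁, h₂, rfl⟩ | ⟨h₁, h₂, s, t, hs, ht, ⟨hts, rfl⟩ | ⟨hts, rfl⟩⟩
  · obtain ⟨-, s, -, hs, -⟩ := id h₁
    have hlt := (hH s hs).1 h₁
    refine hU.swap_right hset hO hc hs hlt fun t ht => ?_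
    rw [hV t ht] at h₂
    omega
  · obtain ⟨-, t, -, ht, -⟩ := id h₁
    have hlt := (hV t ht).1 h₁
    refine hU.swap_up hset hO hc ht hlt fun s hs => ?_
    rw [hH s hs] at h₂
    omega
  · refine hU.swap_right hset hO hc hs ((hH s hs).1 h₁) fun t' ht' => ?_
    obtain rfl : t = t' := by simpa [upCell, ht'] using ht.symm
    exact hts
  · refine hU.swap_up hset hO hc ht ((hV t ht).1 h₂) fun s' hs' => ?_
    obtain rfl : s = s' := by simpa [rtCell, hs'] using hs.symm
    exact hts

/-- Proposition 4.12(2): each iteration of the GG-jdt slide performed during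
the computation of `jdt_GG(T)` results in an `α`-column-strict and
`β`-row-strict tableau. -/
theorem ggjdt_slide_strict (T U U' : MixedTableau)
    (hT : IsMixedTableau T) (ha : AlphaColumnStrict T) (hb : BetaRowStrict T)
    (hs : ABSorted T)
    (hreach : Relation.ReflTransGen GGStep T U) (hstep : GGStep U U') :
    AlphaColumnStrict U' ∧ BetaRowStrict U' := by
  have hU : GGInvariant U := by
    clear hstep
    induction hreach with
    | refl => exact GGInvariant.of_sorted ha hb hs
    | tail _ h ih => exact (ih.step h).2.2
  exact ⟨(hU.step hstep).1, (hU.step hstep).2.1⟩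
end
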